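/- arXiv:0802.0015 — 5 statements merged into one kernel-verified Lean document; each statement's English description precedes it below -/
import Mathlib

section
/- Let q = 2^t for a positive integer t. The dimension over F_2 of the LU(3,q) code equals (after casting to the real numbers) 2^{3t} + 2^{t+1} - 1 - ((1+√17)/2)^{2t} - ((1-√17)/2)^{2t}. -/
open scoped Classical

noncomputable section

variable (k : Type) [Field k] [Fintype k]

/-- The parity check matrix `H(3,q)` over `F_2`: rows indexed by triples `(a,b,c)`,
columns by triples `(x,y,z)`, with entry `1` iff `y = a*x + b` and `z = a*y + c`. -/
def H3 : Matrix (k × k × k) (k × k × k) (ZMod 2) :=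
  fun r c => if c.2.1 = r.1 * c.1 + r.2.1 ∧ c.2.2 = r.1 * c.2.1 + r.2.2 then 1 else 0

/-- The `LU(3,q)` code: the null space of `H(3,q)`, an `F_2`-subspace of the
functions `F_q^3 → F_2`. -/
def LUcode : Submodule (ZMod 2) (k × k × k → ZMod 2) :=
  LinearMap.ker (Matrix.mulVecLin (H3 k))

namespace LU3

section

/-- A letter `(d, ε, η)`: the exponent digit `d` of `x` at one binary position, and the exponents
`ε`, `η` of the two linear forms `c + a x` and `b + c x` at that position. -/
abbrev Letter := Bool × Bool × Bool

/-- A token `(α, β, γ)` stands for the monomial `a^α b^β c^γ` at one binary position, except that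
`(1, 1, 0)` stands for `a b + c²`. -/
abbrev Token := Bool × Bool × Bool

/-- The exponent of `x` accompanying a token in the expansion of `(c + a x)^ε (b + c x)^η`. -/
def expo : Token → Bool × Bool → Option ℕ
  | (false, false, false), (false, false) => some 0
  | (true, false, false), (true, false) => some 1
  | (false, true, false), (false, true) => some 0
  | (false, false, true), (true, false) => some 0
  | (false, false, true), (false, true) => some 1
  | (false, true, true), (true, true) => some 0
  | (true, true, false), (true, true) => some 1
  | (true, false, true), (true, true) => some 2
  | _, _ => none

/-- With incoming carry `p` the token `w` produces the letter `s` and the outgoing carry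
(the last argument). -/
def Emits (w : Token) (s : Letter) (p p' : Bool) : Bool :=
  (expo w s.2).any fun m => m + p.toNat == s.1.toNat + 2 * p'.toNat

/-- The transition function of the automaton recognising the leading strings. -/
def next : Bool → Letter → Option Bool
  | _, (false, false, false) => some false
  | true, (true, false, false) => some false
  | false, (true, false, false) => none
  | true, (false, true, false) => some true
  | false, (false, true, false) => none
  | _, (true, true, false) => some false
  | q, (false, false, true) => some q
  | _, (true, false, true) => some false
  | _, (false, true, true) => some true
  | q, (true, true, true) => some q

variable {n : ℕ}

open Fin.CommRing in
theorem val_nsmul_one (i : Fin (n + 1)) : i.val • (1 : Fin (n + 1)) = i := by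
  rw [nsmul_one]
  exact Fin.cast_val_eq_self i

theorem cyclic_induction {P : Fin (n + 1) → Prop} (i₀ : Fin (n + 1)) (h₀ : P i₀)
    (h : ∀ i, P i → P (i + 1)) (i : Fin (n + 1)) : P i := by
  have key : ∀ m : ℕ, P (i₀ + m • (1 : Fin (n + 1))) := by
    intro m
    induction m with
    | zero => simpa using h₀
    | succ m ih => simpa [succ_nsmul, add_assoc] using h _ ih
  simpa [val_nsmul_one] using key (i - i₀).val

theorem cyclic_induction_sub {P : Fin (n + 1) → Prop} (i₀ : Fin (n + 1)) (h₀ : P i₀)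
    (h : ∀ i, P (i + 1) → P i) (i : Fin (n + 1)) : P i := by
  by_contra hi
  exact cyclic_induction (P := fun j => ¬ P j) i hi (fun j hj hj' => hj (h j hj')) i₀ h₀

theorem exists_forward_recursion (G Q : Fin (n + 1) → Prop) :
    ∃ f : Fin (n + 1) → Bool, (∀ i, f (i + 1) = true ↔ G i ∨ (Q i ∧ f i = true)) ∧
      ((∀ i, ¬ G i) → ∀ i, f i = false) := by
  refine ⟨fun i => decide (∃ m : ℕ, G (i - m • (1 : Fin (n + 1)) - 1) ∧
    ∀ l < m, Q (i - l • (1 : Fin (n + 1)) - 1)), fun i => ?_, fun h i => ?_⟩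
  · simp only [decide_eq_true_eq]
    constructor
    · rintro ⟨m, hm, hl⟩
      cases m with
      | zero => left; simpa using hm
      | succ m =>
        right
        refine ⟨by simpa using hl 0 (Nat.succ_pos _), m, ?_, fun l hlm => ?_⟩
        · convert hm using 1; simp only [succ_nsmul]; abel
        · convert hl (l + 1) (by omega) using 1; simp only [succ_nsmul]; abel
    · rintro (hg | ⟨hq, m, hm, hl⟩)
      · exact ⟨0, by simpa using hg, by simp⟩
      · refine ⟨m + 1, ?_, fun l hlm => ?_⟩
        · convert hm using 1; simp only [succ_nsmul]; abel
        · cases l with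
          | zero => simpa using hq
          | succ l => convert hl l (by omega) using 1; simp only [succ_nsmul]; abel
  · simp [h]

theorem exists_backward_recursion (G Q : Fin (n + 1) → Prop) :
    ∃ f : Fin (n + 1) → Bool, ∀ i, f i = true ↔ G i ∨ (Q i ∧ f (i + 1) = true) := by
  obtain ⟨f, hf, -⟩ := exists_forward_recursion (fun i => G (-i)) (fun i => Q (-i))
  refine ⟨fun i => f (-i + 1), fun i => ?_⟩
  rw [hf, neg_neg]
  simp

/-- The word `w` produces the string `s` with a consistent cyclic choice of carries. The excluded
case is that of `x ^ (q - 1)`, which is not the monomial `1`. -/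
def Produces (w : Fin (n + 1) → Token) (s : Fin (n + 1) → Letter) : Prop :=
  ∃ p : Fin (n + 1) → Bool, (∀ i, Emits (w i) (s i) (p i) (p (i + 1))) ∧
    ¬ ((∀ i, (s i).1 = false) ∧ ∀ i, p i = true)

set_option synthInstance.maxSize 2000 in
set_option synthInstance.maxHeartbeats 200000 in
theorem Produces.unique {w : Fin (n + 1) → Token} {s s' : Fin (n + 1) → Letter}
    (h : Produces w s) (h' : Produces w s') (hs : ∀ i, (s i).2 = (s' i).2) : s = s' := by
  obtain ⟨p, hp, hp0⟩ := h
  obtain ⟨p', hp', hp0'⟩ := h'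
  have tab : ∀ (w : Token) (t : Bool × Bool) (d d' p p₁ p' p₁' : Bool),
      Emits w (d, t) p p₁ → Emits w (d', t) p' p₁' →
      (p = p' → d = d' ∧ p₁ = p₁') ∧
      (p = true → p' = false → p₁ = p₁' ∨ (p₁ = true ∧ p₁' = false ∧ d = false)) := by
    decide
  have tab1 := fun i => tab (w i) (s i).2 (s i).1 (s' i).1 (p i) (p (i + 1)) (p' i) (p' (i + 1))
    (hp i) (by rw [hs]; exact hp' i)
  have tab2 := fun i => tab (w i) (s i).2 (s' i).1 (s i).1 (p' i) (p' (i + 1)) (p i) (p (i + 1))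
    (by rw [hs]; exact hp' i) (hp i)
  by_cases hex : ∃ i, p i = p' i
  · obtain ⟨i₀, h₀⟩ := hex
    have hall := cyclic_induction (P := fun i => p i = p' i) i₀ h₀ fun i hi => ((tab1 i).1 hi).2
    funext i
    exact Prod.ext ((tab1 i).1 (hall i)).1 (hs i)
  · push Not at hex
    exfalso
    rcases hb : p 0 with _ | _
    · have hb' : p' 0 = true := by
        have := hex 0
        rw [hb] at this
        exact Bool.eq_true_of_not_eq_false this.symm
      have hall := cyclic_induction (P := fun i => p' i = true ∧ p i = false) 0 ⟨hb', hb⟩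
        fun i hi => by
          rcases (tab2 i).2 hi.1 hi.2 with h | h
          · exact absurd h.symm (hex _)
          · exact ⟨h.1, h.2.1⟩
      refine hp0' ⟨fun i => ?_, fun i => (hall i).1⟩
      rcases (tab2 i).2 (hall i).1 (hall i).2 with h | h
      · exact absurd h.symm (hex _)
      · exact h.2.2
    · have hb' : p' 0 = false := by
        have := hex 0
        rw [hb] at this
        exact Bool.eq_false_of_not_eq_true this.symm
      have hall := cyclic_induction (P := fun i => p i = true ∧ p' i = false) 0 ⟨hb, hb'⟩
        fun i hi => by
          rcases (tab1 i).2 hi.1 hi.2 with h | h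
          · exact absurd h (hex _)
          · exact ⟨h.1, h.2.1⟩
      refine hp0 ⟨fun i => ?_, fun i => (hall i).1⟩
      rcases (tab1 i).2 (hall i).1 (hall i).2 with h | h
      · exact absurd h (hex _)
      · exact h.2.2

set_option synthInstance.maxSize 2000 in
set_option synthInstance.maxHeartbeats 200000 in
theorem exists_produces {w : Fin (n + 1) → Token} {t : Fin (n + 1) → Bool × Bool}
    (h : ∀ i, (expo (w i) (t i)).isSome) :
    ∃ d : Fin (n + 1) → Bool, Produces w fun i => (d i, t i) := by
  obtain ⟨p, hp, hp0⟩ := exists_forward_recursion (fun i => expo (w i) (t i) = some 2)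
    (fun i => expo (w i) (t i) = some 1)
  have tab : ∀ (w : Token) (t : Bool × Bool) (p p' : Bool), (expo w t).isSome →
      (p' = true ↔ expo w t = some 2 ∨ (expo w t = some 1 ∧ p = true)) →
      ∃ d, Emits w (d, t) p p' ∧ (d = false → p' = true → expo w t = some 2 ∨ expo w t = some 1) ∧
        (d = false → p = true → ¬ expo w t = some 2) := by
    decide
  choose d hd hd' hd'' using fun i => tab (w i) (t i) (p i) (p (i + 1)) (h i) (hp i)
  refine ⟨d, p, hd, ?_⟩
  rintro ⟨hd0, hp1⟩
  have : ∀ i, p i = false := hp0 fun i => hd'' i (hd0 i) (hp1 i)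
  simp [hp1] at this

/-- A closed run of the automaton on the cyclic string `s`. -/
def IsRun (s : Fin (n + 1) → Letter) (q : Fin (n + 1) → Bool) : Prop :=
  ∀ i, next (q i) (s i) = some (q (i + 1))

/-- Runs that do not correspond to a leading string. -/
def IsExceptional (s : Fin (n + 1) → Letter) (q : Fin (n + 1) → Bool) : Prop :=
  (∀ i, q i = true) ∧
    ((∀ i, s i = (true, true, true) ∨ s i = (false, false, true)) ∨
      ∀ i, s i = (false, true, false) ∨ s i = (false, false, true))

/-- The strings with a closed run that is not exceptional. -/
def Accepted (s : Fin (n + 1) → Letter) : Prop :=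
  ∃ q, IsRun s q ∧ ¬ IsExceptional s q

end

section

variable {n : ℕ}

set_option synthInstance.maxSize 2000 in
set_option synthInstance.maxHeartbeats 200000 in
theorem next_of_recursion : ∀ (s : Letter) (q q' : Bool),
    (q' = true ↔ s = (false, true, true) ∨
      ((s = (true, true, true) ∨ s = (false, true, false) ∨ s = (false, false, true)) ∧
        q = true)) →
    ¬ (q = false ∧ (s = (false, true, false) ∨ s = (true, false, false))) →
    next q s = some q' := by
  decide

set_option synthInstance.maxSize 2000 in
set_option synthInstance.maxHeartbeats 200000 in
theorem Emits.of_carry : ∀ {w : Token} {s : Letter} {p : Bool}, Emits w s p true →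
    s = (false, true, true) ∨ (p = true ∧
      (s = (true, true, true) ∨ s = (false, true, false) ∨ s = (false, false, true))) := by
  decide

set_option synthInstance.maxSize 2000 in
set_option synthInstance.maxHeartbeats 200000 in
theorem emits_swap : ∀ (w : Token) (p' : Bool), Emits w (false, true, false) false p' ↔
    Emits w (true, false, true) false p' := by
  decide

set_option synthInstance.maxSize 2000 in
set_option synthInstance.maxHeartbeats 200000 in
theorem not_emits_carry : ∀ (w : Token) (p : Bool), ¬ Emits w (true, false, true) p true := by
  decide

set_option synthInstance.maxSize 2000 in
set_option synthInstance.maxHeartbeats 200000 in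
theorem not_emits_zero : ∀ (w : Token) (p' : Bool), ¬ Emits w (true, false, false) false p' := by
  decide

/-- The number of positions carrying the letter `c + a x`. -/
def numE1 (s : Fin (n + 1) → Letter) : ℕ :=
  (Finset.univ.filter fun i => s i = (false, true, false)).card

theorem exists_relation_of_not_accepted {s : Fin (n + 1) → Letter} (hs : ¬ Accepted s) :
    (∀ w, ¬ Produces w s) ∨
      ∃ s', numE1 s' < numE1 s ∧ ∀ w, Produces w s ↔ Produces w s' := by
  obtain ⟨q, hq, hq0⟩ := exists_forward_recursion (fun i => s i = (false, true, true))
    (fun i => s i = (true, true, true) ∨ s i = (false, true, false) ∨ s i = (false, false, true))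
  obtain ⟨j, hj, hsj⟩ : ∃ j, q j = false ∧
      (s j = (false, true, false) ∨ s j = (true, false, false)) := by
    by_contra hno
    refine hs ⟨q, fun i => next_of_recursion _ _ _ (hq i) fun h => hno ⟨i, h⟩, ?_⟩
    rintro ⟨h1, h2⟩
    have : ∀ i, q i = false := hq0 fun i hi => by
      rcases h2 with h2 | h2 <;> rcases h2 i with h3 | h3 <;> simp [hi] at h3
    simp [h1] at this
  have step : ∀ {w p} i, Emits w (s i) p true → q (i + 1) = false →
      (p = true ∧ q i = false) ∧
        (s i = (true, true, true) ∨ s i = (false, true, false) ∨ s i = (false, false, true)) := by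
    intro w p i he hqi
    have h1 := hq i
    rcases Emits.of_carry he with h | ⟨hp, h⟩
    · simp [hqi, h] at h1
    · refine ⟨⟨hp, ?_⟩, h⟩
      by_contra hqi'
      rw [Bool.not_eq_false] at hqi'
      rw [hqi] at h1
      exact absurd (h1.2 (Or.inr ⟨h, hqi'⟩)) (by simp)
  have zero : ∀ {w : Fin (n + 1) → Token} {p : Fin (n + 1) → Bool},
      (∀ i, Emits (w i) (s i) (p i) (p (i + 1))) → ¬ ((∀ i, (s i).1 = false) ∧ ∀ i, p i = true) → p j = false := by
    intro w p hp hp0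
    by_contra hpj
    rw [Bool.not_eq_false] at hpj
    have hall := cyclic_induction_sub (P := fun i => p i = true ∧ q i = false) j ⟨hpj, hj⟩
      fun i hi => (step i (hi.1 ▸ hp i) hi.2).1
    have hlet := fun i => (step i ((hall (i + 1)).1 ▸ hp i) (hall (i + 1)).2).2
    by_cases h1 : ∃ i, s i = (true, true, true)
    · by_cases h2 : ∃ i, s i = (false, true, false)
      · obtain ⟨i, hi⟩ := h1
        obtain ⟨i', hi'⟩ := h2
        refine hs ⟨fun _ => true, fun i => ?_, ?_⟩
        · rcases hlet i with h | h | h <;> rw [h] <;> rfl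
        · rintro ⟨-, h | h⟩
          · have := h i'; simp [hi'] at this
          · have := h i; simp [hi] at this
      · refine hs ⟨fun _ => false, fun i => ?_, fun h => by simpa using h.1 0⟩
        rcases hlet i with h | h | h
        · rw [h]; rfl
        · exact absurd ⟨i, h⟩ h2
        · rw [h]; rfl
    · refine hp0 ⟨fun i => ?_, fun i => (hall i).1⟩
      rcases hlet i with h | h | h
      · exact absurd ⟨i, h⟩ h1
      · rw [h]
      · rw [h]
  rcases hsj with hsj | hsj
  · right
    refine ⟨Function.update s j (true, false, true), ?_, fun w => ⟨?_, ?_⟩⟩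
    · refine Finset.card_lt_card (Finset.ssubset_iff_of_subset ?_ |>.2
        ⟨j, by simpa using hsj, by simp⟩)
      intro i
      by_cases hij : i = j
      · subst hij; simp
      · simp [hij]
    · rintro ⟨p, hp, hp0⟩
      have hpj := zero hp hp0
      refine ⟨p, fun i => ?_, fun h => by simpa [hpj] using h.2 j⟩
      by_cases hij : i = j
      · subst hij
        have := hp i
        rw [hsj, hpj, emits_swap] at this
        simpa [hpj] using this
      · simpa [hij] using hp i
    · rintro ⟨p, hp, hp0⟩
      have hpj : p j = false := by
        by_contra hpj
        rw [Bool.not_eq_false] at hpj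
        have hj' : p (j + 1) ≠ true := fun h => by
          have := hp j
          rw [h, Function.update_self] at this
          exact not_emits_carry _ _ this
        refine hj' (cyclic_induction_sub (P := fun i => p i = true ∧ q i = false) j ⟨hpj, hj⟩
          (fun i hi => ?_) (j + 1)).1
        have hij : i ≠ j := by
          rintro rfl
          exact hj' hi.1
        have := hp i
        rw [Function.update_of_ne hij, hi.1] at this
        exact (step i this hi.2).1
      refine ⟨p, fun i => ?_, fun h => by simpa [hpj] using h.2 j⟩
      by_cases hij : i = j
      · subst hij
        have := hp i
        rw [Function.update_self, hpj, ← emits_swap] at this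
        rwa [hsj, hpj]
      · simpa [hij] using hp i
  · left
    rintro w ⟨p, hp, hp0⟩
    have := hp j
    rw [hsj, zero hp hp0] at this
    exact not_emits_zero _ _ this

end

section

variable {n : ℕ}

/-- The token by which a letter is reached with given incoming and outgoing carry. -/
def tok : Letter → Bool → Bool → Token
  | (false, true, true), _, p' => if p' then (true, false, true) else (false, true, true)
  | (true, true, true), _, p' => if p' then (true, false, true) else (true, true, false)
  | (false, true, false), _, p' => if p' then (true, false, false) else (false, false, true)
  | (false, false, true), _, p' => if p' then (false, false, true) else (false, true, false)
  | (true, true, false), _, _ => (true, false, false)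
  | (true, false, true), p, _ => if p then (false, true, false) else (false, false, true)
  | (_, false, false), _, _ => (false, false, false)

/-- The weight of a letter. -/
def wt : Letter → ℕ
  | (false, true, false) => 2
  | (_, false, true) => 1
  | _ => 0

/-- The carries along a string with run `q`: `x₃` and `x (b + c x)` in state `true` create a
carry, which travels backwards. -/
def CarryRec (s : Letter) (q p p' : Bool) : Prop :=
  p = true ↔ (s = (true, false, false) ∨ (s = (true, false, true) ∧ q = true)) ∨
    ((s = (true, true, true) ∨ s = (false, true, false) ∨ s = (false, false, true)) ∧ p' = true)

instance (s : Letter) (q p p' : Bool) : Decidable (CarryRec s q p p') := by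
  unfold CarryRec
  infer_instance

/-- The relation between state and carry of a string and of another one for the same word. -/
def Related (q p r c : Bool) : Prop :=
  (c = p ∧ (r = true → q = true)) ∨ (c = false ∧ p = true ∧ q = true ∧ r = false)

instance (q p r c : Bool) : Decidable (Related q p r c) := by
  unfold Related
  infer_instance

set_option synthInstance.maxSize 2000 in
set_option synthInstance.maxHeartbeats 200000 in
theorem carry_propagate : ∀ (s : Letter) (p p' q' : Bool), CarryRec s false p p' →
    next false s = some q' → p = true → s ≠ (false, true, true) ∧ p' = true ∧ q' = false := by
  decide

set_option synthInstance.maxSize 2000 in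
set_option synthInstance.maxHeartbeats 200000 in
theorem emits_tok : ∀ (s : Letter) (q q' p p' : Bool), CarryRec s q p p' →
    next q s = some q' → (p' = true → q' = true) → Emits (tok s p p') s p p' := by
  decide

set_option synthInstance.maxSize 2000 in
set_option synthInstance.maxHeartbeats 200000 in
theorem carry_of_one : ∀ (q p p' : Bool), CarryRec (false, true, true) q p p' → p = false := by
  decide

set_option synthInstance.maxSize 2000 in
set_option synthInstance.maxHeartbeats 200000 in
set_option maxRecDepth 100000 in
theorem related_of_one : ∀ (q q' p p' : Bool), CarryRec (false, true, true) q p p' →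
    next q (false, true, true) = some q' → ∀ (s : Letter) (r c c' : Bool),
    Emits (tok (false, true, true) p p') s c c' → ∀ r', next r s = some r' →
      Related q' p' r' c' := by
  decide

set_option synthInstance.maxSize 2000 in
set_option synthInstance.maxHeartbeats 200000 in
set_option maxRecDepth 100000 in
theorem related_step : ∀ (s : Letter) (q q' : Bool), next q s = some q' →
    ∀ p p', CarryRec s q p p' → (p = true → q = true) → (p' = true → q' = true) →
    ∀ r c, Related q p r c → ∀ (u : Letter) (c' : Bool), Emits (tok s p p') u c c' →
    ∀ r', next r u = some r' →
      Related q' p' r' c' ∧ wt u ≤ wt s ∧ (s.2 ≠ u.2 → wt u < wt s) ∧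
        (s = (false, true, true) → u = (false, true, true)) := by
  decide

set_option synthInstance.maxSize 2000 in
set_option synthInstance.maxHeartbeats 200000 in
set_option maxRecDepth 100000 in
theorem emits_tok_true : ∀ s : Letter,
    (s = (true, true, true) ∨ s = (false, true, false) ∨ s = (false, false, true)) →
    Emits (tok s true true) s true true ∧ ∀ u p p', Emits (tok s true true) u p p' →
      u ≠ (false, true, true) → (p = false → p' = false) ∧
        (p = true → p' = true → u = s) ∧ (s = (true, true, true) → p = true) := by
  decide

set_option synthInstance.maxSize 2000 in
set_option synthInstance.maxHeartbeats 200000 in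
set_option maxRecDepth 100000 in
theorem emits_tok_false : ∀ s : Letter, s ≠ (false, true, true) → next false s = some false →
    Emits (tok s false false) s false false ∧ ∀ u p p', Emits (tok s false false) u p p' →
      u ≠ (false, true, true) → next false u = some false →
      (p = false → p' = false ∧ u = s) ∧ (p' = true → u.1 = false) := by
  decide

set_option synthInstance.maxSize 2000 in
set_option synthInstance.maxHeartbeats 200000 in
theorem next_eq_true : ∀ (s : Letter) (q : Bool), s ≠ (false, true, true) →
    next q s = some true → q = true ∧
      (s = (true, true, true) ∨ s = (false, true, false) ∨ s = (false, false, true)) := by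
  decide

theorem exists_word_of_one {s : Fin (n + 1) → Letter} {q : Fin (n + 1) → Bool} (hq : IsRun s q)
    {j : Fin (n + 1)} (hj : s j = (false, true, true)) :
    ∃ w, Produces w s ∧ ∀ u, Accepted u → Produces w u → u ≠ s →
      (∃ i, u i = (false, true, true)) ∧ ∑ i, wt (u i) < ∑ i, wt (s i) := by
  obtain ⟨p, hp⟩ := exists_backward_recursion
    (fun i => s i = (true, false, false) ∨ (s i = (true, false, true) ∧ q i = true))
    (fun i => s i = (true, true, true) ∨ s i = (false, true, false) ∨ s i = (false, false, true))
  have hp : ∀ i, CarryRec (s i) (q i) (p i) (p (i + 1)) := hp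
  have hpj : p j = false := carry_of_one (q j) _ (p (j + 1)) (hj ▸ hp j)
  have hpq : ∀ i, p i = true → q i = true := by
    intro i hpi
    by_contra hqi
    rw [Bool.not_eq_true] at hqi
    have := cyclic_induction (P := fun i => p i = true ∧ q i = false) i ⟨hpi, hqi⟩
      (fun l hl => by
        have h1 := hp l
        have h2 := hq l
        rw [hl.2] at h1 h2
        exact (carry_propagate _ _ _ _ h1 h2 hl.1).2) j
    simp [hpj] at this
  have hw : Produces (fun i => tok (s i) (p i) (p (i + 1))) s :=
    ⟨p, fun i => emits_tok _ _ _ _ _ (hp i) (hq i) (hpq _), fun h => by simpa [hpj] using h.2 j⟩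
  refine ⟨_, hw, ?_⟩
  rintro u ⟨r, hr, -⟩ hu hus
  obtain ⟨c, hc, -⟩ := id hu
  have step := fun i h => related_step (s i) (q i) _ (hq i) _ _ (hp i) (hpq i) (hpq _) (r i) (c i) h
    _ _ (hc i) _ (hr i)
  have hrel := cyclic_induction (P := fun i => Related (q i) (p i) (r i) (c i)) (j + 1)
    (related_of_one (q j) _ (p j) _ (hj ▸ hp j) (hj ▸ hq j) (u j) (r j) (c j) _
      (by simpa only [hj] using hc j) _ (hr j)) fun i h => (step i h).1
  refine ⟨⟨j, (step j (hrel j)).2.2.2 hj⟩, ?_⟩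
  refine Finset.sum_lt_sum (fun i _ => (step i (hrel i)).2.1) ?_
  by_contra hno
  push Not at hno
  refine hus (hu.unique hw fun i => ?_)
  by_contra hne
  exact absurd ((step i (hrel i)).2.2.1 (Ne.symm hne)) (not_lt.2 (hno i (Finset.mem_univ i)))

theorem exists_word_of_true {s : Fin (n + 1) → Letter}
    (hs : ∀ i, s i = (true, true, true) ∨ s i = (false, true, false) ∨ s i = (false, false, true))
    {j : Fin (n + 1)} (hj : s j = (true, true, true)) :
    ∃ w, Produces w s ∧ ∀ u, Produces w u → u ≠ s → ∃ i, u i = (false, true, true) := by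
  refine ⟨fun i => tok (s i) true true, ⟨fun _ => true, fun i => (emits_tok_true _ (hs i)).1,
    fun h => by simpa [hj] using h.1 j⟩, ?_⟩
  rintro u ⟨p, hp, -⟩ hus
  by_contra hno
  push Not at hno
  have step := fun i => (emits_tok_true _ (hs i)).2 _ _ _ (hp i) (hno i)
  have hall : ∀ i, p i = true := by
    intro i
    by_contra hpi
    rw [Bool.not_eq_true] at hpi
    have := cyclic_induction (P := fun i => p i = false) i hpi (fun l hl => (step l).1 hl) j
    simp [(step j).2.2 hj] at this
  exact hus (funext fun i => (step i).2.1 (hall i) (hall _))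

theorem exists_word_of_false {s : Fin (n + 1) → Letter} (h1 : ∀ i, s i ≠ (false, true, true))
    (hs : ∀ i, next false (s i) = some false) :
    ∃ w, Produces w s ∧ ∀ u, Produces w u → (∀ i, u i ≠ (false, true, true)) →
      (∀ i, next false (u i) = some false) → u = s := by
  refine ⟨fun i => tok (s i) false false,
    ⟨fun _ => false, fun i => (emits_tok_false _ (h1 i) (hs i)).1,
      fun h => by simpa using h.2 0⟩, ?_⟩
  rintro u ⟨p, hp, hp0⟩ hu1 hu
  have step := fun i => (emits_tok_false _ (h1 i) (hs i)).2 _ _ _ (hp i) (hu1 i) (hu i)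
  by_cases h : ∃ i, p i = false
  · obtain ⟨i₀, h₀⟩ := h
    have hall := cyclic_induction (P := fun i => p i = false) i₀ h₀ fun i hi => ((step i).1 hi).1
    exact funext fun i => ((step i).1 (hall i)).2
  · push Not at h
    simp only [ne_eq, Bool.not_eq_false] at h
    exact absurd ⟨fun i => (step i).2 (h _), h⟩ hp0

theorem Accepted.cases {s : Fin (n + 1) → Letter} (hs : Accepted s) :
    (∃ j, s j = (false, true, true)) ∨
    ((∀ i, s i = (true, true, true) ∨ s i = (false, true, false) ∨ s i = (false, false, true)) ∧
      ∃ j, s j = (true, true, true)) ∨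
    ((∀ i, s i ≠ (false, true, true)) ∧ ∀ i, next false (s i) = some false) := by
  obtain ⟨q, hq, hq0⟩ := hs
  by_cases h1 : ∃ j, s j = (false, true, true)
  · exact Or.inl h1
  push Not at h1
  refine Or.inr ?_
  by_cases h : ∃ i, q i = true
  · obtain ⟨i₀, h₀⟩ := h
    left
    have step := fun i (h : q (i + 1) = true) => next_eq_true (s i) (q i) (h1 i) (h ▸ hq i)
    have hall := cyclic_induction_sub (P := fun i => q i = true) i₀ h₀ fun i hi => (step i hi).1
    have hlet := fun i => (step i (hall _)).2
    refine ⟨hlet, ?_⟩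
    by_contra hno
    push Not at hno
    exact hq0 ⟨hall, Or.inr fun i => (hlet i).resolve_left (hno i)⟩
  · push Not at h
    simp only [ne_eq, Bool.not_eq_true] at h
    exact Or.inr ⟨h1, fun i => by simpa [h] using hq i⟩

/-- The incidence matrix between words and the strings they produce. -/
def prodMatrix (K : Type*) [Field K] (n : ℕ) :
    Matrix (Fin (n + 1) → Token) (Fin (n + 1) → Letter) K :=
  Matrix.of fun w s => if Produces w s then 1 else 0

variable {K : Type*} [Field K]

theorem eq_zero_of_mulVec_eq_zero {v : (Fin (n + 1) → Letter) → K}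
    (hv : (prodMatrix K n).mulVec v = 0) (h0 : ∀ s, ¬ Accepted s → v s = 0) : v = 0 := by
  have single : ∀ {w s}, Produces w s →
      (∀ u, Accepted u → Produces w u → u ≠ s → v u = 0) → v s = 0 := by
    intro w s hw hu
    have h := congrFun hv w
    simp only [Matrix.mulVec, dotProduct, prodMatrix, Matrix.of_apply, ite_mul, one_mul, zero_mul,
      Pi.zero_apply] at h
    rwa [Finset.sum_eq_single s, if_pos hw] at h
    · intro u _ hus
      split_ifs with hwu
      · by_cases hacc : Accepted u
        · exact hu u hacc hwu hus
        · exact h0 u hacc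
      · rfl
    · simp
  have hA : ∀ m : ℕ, ∀ s, ∑ i, wt (s i) = m → Accepted s → (∃ j, s j = (false, true, true)) →
      v s = 0 := by
    intro m
    induction m using Nat.strong_induction_on with
    | _ m ih =>
      rintro s hm ⟨q, hq, -⟩ ⟨j, hj⟩
      obtain ⟨w, hw, hu⟩ := exists_word_of_one hq hj
      refine single hw fun u hacc hwu hus => ?_
      obtain ⟨h1, h2⟩ := hu u hacc hwu hus
      exact ih _ (hm ▸ h2) u rfl hacc h1
  have hC : ∀ s, (∀ i, s i = (true, true, true) ∨ s i = (false, true, false) ∨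
      s i = (false, false, true)) → (∃ j, s j = (true, true, true)) → v s = 0 := by
    rintro s hs ⟨j, hj⟩
    obtain ⟨w, hw, hu⟩ := exists_word_of_true hs hj
    exact single hw fun u hacc hwu hus => hA _ u rfl hacc (hu u hwu hus)
  funext s
  by_cases hacc : Accepted s
  · rcases hacc.cases with h | h | ⟨h1, h2⟩
    · exact hA _ s rfl hacc h
    · exact hC s h.1 h.2
    · obtain ⟨w, hw, hu⟩ := exists_word_of_false h1 h2
      refine single hw fun u hacc' hwu hus => ?_
      rcases hacc'.cases with h | h | h
      · exact hA _ u rfl hacc' h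
      · exact hC u h.1 h.2
      · exact absurd (hu u hwu h.1 h.2) hus
  · exact h0 s hacc

end

section

variable {n : ℕ} {K : Type*} [Field K]

theorem prodMatrix_mulVec_single (s : Fin (n + 1) → Letter) (w : Fin (n + 1) → Token) :
    (prodMatrix K n).mulVec (Pi.single s 1) w = if Produces w s then 1 else 0 := by
  simp [prodMatrix]

/-- Restriction of a kernel vector to the strings that are not accepted. -/
def restrictKer (K : Type*) [Field K] (n : ℕ) :
    LinearMap.ker (prodMatrix K n).mulVecLin →ₗ[K]
      ({s : Fin (n + 1) → Letter // ¬ Accepted s} → K) :=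
  LinearMap.funLeft K K Subtype.val ∘ₗ Submodule.subtype _

theorem restrictKer_injective : Function.Injective (restrictKer K n) := by
  rw [← LinearMap.ker_eq_bot, LinearMap.ker_eq_bot']
  rintro ⟨v, hv⟩ h
  ext1
  exact eq_zero_of_mulVec_eq_zero (by simpa using hv) fun s hs => congrFun h ⟨s, hs⟩

theorem restrictKer_surjective [CharP K 2] : Function.Surjective (restrictKer K n) := by
  rw [← LinearMap.range_eq_top, ← top_le_iff, ← (Pi.basisFun K _).span_eq, Submodule.span_le]
  rintro _ ⟨⟨s, hs⟩, rfl⟩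
  have key : ∀ m : ℕ, ∀ s (hs : ¬ Accepted s), numE1 s = m →
      Pi.single ⟨s, hs⟩ 1 ∈ LinearMap.range (restrictKer K n) := by
    intro m
    induction m using Nat.strong_induction_on with
    | _ m ih =>
      intro s hs hm
      rcases exists_relation_of_not_accepted hs with h | ⟨u, hu, h⟩
      · refine ⟨⟨Pi.single s 1, ?_⟩, ?_⟩
        · ext w
          simpa [h, Matrix.mulVecLin_apply] using prodMatrix_mulVec_single (K := K) s w
        · ext ⟨r, hr⟩
          simp [restrictKer, Pi.single_apply]
      · have hker : (Pi.single s 1 + Pi.single u 1 : (Fin (n + 1) → Letter) → K) ∈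
            LinearMap.ker (prodMatrix K n).mulVecLin := by
          rw [LinearMap.mem_ker, Matrix.mulVecLin_apply, Matrix.mulVec_add]
          ext w
          rw [Pi.add_apply, prodMatrix_mulVec_single, prodMatrix_mulVec_single, h w]
          exact CharTwo.add_self_eq_zero _
        have hmem := LinearMap.mem_range_self (restrictKer K n) ⟨_, hker⟩
        by_cases hacc : Accepted u
        · convert hmem using 1
          ext ⟨r, hr⟩
          have : r ≠ u := by rintro rfl; exact hr hacc
          simp [restrictKer, Pi.single_apply, this]
        · have hmem' := Submodule.sub_mem _ hmem (ih _ (hm ▸ hu) u hacc rfl)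
          convert hmem' using 1
          ext ⟨r, hr⟩
          simp [restrictKer, Pi.single_apply]
  simpa using key _ s hs rfl

theorem rank_prodMatrix [CharP K 2] :
    (prodMatrix K n).rank = Fintype.card {s : Fin (n + 1) → Letter // Accepted s} := by
  have h1 := LinearMap.finrank_range_add_finrank_ker (prodMatrix K n).mulVecLin
  have h2 := (LinearEquiv.ofBijective (restrictKer K n)
    ⟨restrictKer_injective, restrictKer_surjective⟩).finrank_eq
  rw [h2, Module.finrank_fintype_fun_eq_card, Module.finrank_fintype_fun_eq_card,
    Fintype.card_subtype_compl] at h1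
  have h3 := Fintype.card_subtype_le (Accepted (n := n))
  rw [Matrix.rank]
  omega

end

section

theorem sum_prod_path {Q R : Type*} [Fintype Q] [DecidableEq Q] [CommSemiring R]
    (M : Matrix Q Q R) (n : ℕ) (g : Q → Q → R) :
    ∑ f : Fin (n + 1) → Q, (∏ i : Fin n, M (f i.castSucc) (f i.succ)) * g (f 0) (f (Fin.last n)) =
      ∑ a, ∑ b, (M ^ n) a b * g a b := by
  induction n generalizing g with
  | zero =>
    rw [← (Equiv.funUnique (Fin 1) Q).symm.sum_comp]
    simp [Matrix.one_apply]
  | succ n ih =>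
    rw [← (Fin.consEquiv fun _ => Q).sum_comp, Fintype.sum_prod_type]
    refine Finset.sum_congr rfl fun a _ => ?_
    have h := ih fun b c => M a b * g a c
    simp only [Fin.consEquiv_apply, Fin.prod_univ_succ, Fin.castSucc_zero, Fin.cons_zero,
      Fin.cons_succ, ← Fin.succ_castSucc, ← Fin.succ_last]
    calc _ = _ := Finset.sum_congr rfl fun f _ => by ring
      _ = _ := h
      _ = _ := by
        rw [Finset.sum_comm]
        refine Finset.sum_congr rfl fun c _ => ?_
        rw [pow_succ', Matrix.mul_apply, Finset.sum_mul]
        exact Finset.sum_congr rfl fun b _ => by ring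

theorem sum_prod_cycle {Q R : Type*} [Fintype Q] [DecidableEq Q] [CommSemiring R]
    (M : Matrix Q Q R) (n : ℕ) :
    ∑ f : Fin (n + 1) → Q, ∏ i, M (f i) (f (i + 1)) = (M ^ (n + 1)).trace := by
  calc _ = _ := Finset.sum_congr rfl fun f _ => by
        rw [Fin.prod_univ_castSucc, Fin.last_add_one]
        simp only [Fin.coeSucc_eq_succ]
      _ = _ := sum_prod_path M n fun a b => M b a
      _ = _ := by simp [pow_succ, Matrix.trace, Matrix.mul_apply]

/-- The number of letters leading from one state to another. -/
def transfer : Matrix Bool Bool ℤ :=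
  Matrix.of fun q q' => ((Finset.univ.filter fun s => next q s = some q').card : ℤ)

theorem transfer_eq : transfer = Matrix.of fun q q' => if q then 4 else if q' then 1 else 5 := by
  ext q q'
  cases q <;> cases q' <;> rfl

theorem trace_transfer_pow (t : ℕ) : ((transfer ^ t).trace : ℝ) =
    ((1 + Real.sqrt 17) / 2) ^ (2 * t) + ((1 - Real.sqrt 17) / 2) ^ (2 * t) := by
  have hsq : transfer ^ 2 = 9 • transfer - 16 • (1 : Matrix Bool Bool ℤ) := by
    rw [transfer_eq, pow_two]
    ext q q'
    cases q <;> cases q' <;> simp [Matrix.mul_apply, Matrix.ofNat_apply]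
  have hrec : ∀ t, (transfer ^ (t + 2)).trace =
      9 * (transfer ^ (t + 1)).trace - 16 * (transfer ^ t).trace := by
    intro t
    rw [pow_add, hsq, mul_sub, mul_smul_comm, mul_smul_comm, mul_one, ← pow_succ,
      Matrix.trace_sub, Matrix.trace_smul, Matrix.trace_smul]
    simp
  have h17 : Real.sqrt 17 ^ 2 = 17 := Real.sq_sqrt (by norm_num)
  have key : ∀ t, ((transfer ^ t).trace : ℝ) =
      ((1 + Real.sqrt 17) / 2) ^ (2 * t) + ((1 - Real.sqrt 17) / 2) ^ (2 * t) ∧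
      ((transfer ^ (t + 1)).trace : ℝ) =
      ((1 + Real.sqrt 17) / 2) ^ (2 * (t + 1)) + ((1 - Real.sqrt 17) / 2) ^ (2 * (t + 1)) := by
    intro t
    induction t with
    | zero =>
      constructor
      · norm_num [Matrix.trace]
      · simp only [zero_add, pow_one, mul_one, transfer_eq, Matrix.trace, Matrix.diag]
        norm_num
        linear_combination -h17 / 2
    | succ t ih =>
      refine ⟨ih.2, ?_⟩
      rw [hrec]
      push_cast
      rw [ih.1, ih.2]
      simp only [pow_mul]
      have e : ∀ x : ℝ, x ^ 2 = 9 * x - 16 → 9 * x ^ (t + 1) - 16 * x ^ t = x ^ (t + 1 + 1) :=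
        fun x hx => by linear_combination -x ^ t * hx
      rw [← e _ (_ : (((1 + Real.sqrt 17) / 2) ^ 2) ^ 2 = _),
        ← e _ (_ : (((1 - Real.sqrt 17) / 2) ^ 2) ^ 2 = _)]
      · ring
      · have h4 : Real.sqrt 17 ^ 4 = 289 := by linear_combination (Real.sqrt 17 ^ 2 + 17) * h17
        have h3 : Real.sqrt 17 ^ 3 = 17 * Real.sqrt 17 := by linear_combination Real.sqrt 17 * h17
        ring_nf
        rw [h4, h3, h17]
        ring
      · have h4 : Real.sqrt 17 ^ 4 = 289 := by linear_combination (Real.sqrt 17 ^ 2 + 17) * h17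
        have h3 : Real.sqrt 17 ^ 3 = 17 * Real.sqrt 17 := by linear_combination Real.sqrt 17 * h17
        ring_nf
        rw [h4, h3, h17]
        ring
  exact (key t).1

variable {n : ℕ}

theorem card_isRun : ((Finset.univ.filter fun x : (Fin (n + 1) → Letter) × (Fin (n + 1) → Bool) =>
    IsRun x.1 x.2).card : ℤ) = (transfer ^ (n + 1)).trace := by
  rw [← sum_prod_cycle, Finset.card_filter, Fintype.sum_prod_type_right]
  push_cast
  refine Finset.sum_congr rfl fun q _ => ?_
  have : (Finset.univ.filter fun s => IsRun s q) =
      Fintype.piFinset fun i => Finset.univ.filter fun s => next (q i) s = some (q (i + 1)) := by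
    ext s
    simp only [Finset.mem_filter, Fintype.mem_piFinset, Finset.mem_univ, true_and]
    rfl
  rw [Finset.sum_boole, this, Fintype.card_piFinset]
  simp [transfer]

set_option synthInstance.maxSize 2000 in
set_option synthInstance.maxHeartbeats 200000 in
theorem next_parallel : ∀ (s : Letter) (q r q' r' : Bool), next q s = some q' →
    next r s = some r' → (q = r → q' = r') ∧ (q = true → q' ≠ r' → q' = true ∧
      (s = (true, true, true) ∨ s = (false, false, true))) := by
  decide

theorem IsRun.eq_of_eq {s : Fin (n + 1) → Letter} {q r : Fin (n + 1) → Bool} (hq : IsRun s q)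
    (hr : IsRun s r) {j : Fin (n + 1)} (hj : q j = r j) : q = r :=
  funext (cyclic_induction (P := fun i => q i = r i) j hj fun i hi =>
    (next_parallel _ _ _ _ _ (hq i) (hr i)).1 hi)

theorem IsRun.isExceptional {s : Fin (n + 1) → Letter} {q r : Fin (n + 1) → Bool} (hq : IsRun s q)
    (hr : IsRun s r) (h : ∀ i, q i ≠ r i) (h0 : q 0 = true) : IsExceptional s q := by
  have step := fun i hi => (next_parallel _ _ _ _ _ (hq i) (hr i)).2 hi (h (i + 1))
  have hall := cyclic_induction (P := fun i => q i = true) 0 h0 fun i hi => (step i hi).1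
  exact ⟨hall, Or.inl fun i => (step i (hall i)).2⟩

theorem IsRun.unique {s : Fin (n + 1) → Letter} {q r : Fin (n + 1) → Bool} (hq : IsRun s q)
    (hr : IsRun s r) (hq' : ¬ IsExceptional s q) (hr' : ¬ IsExceptional s r) : q = r := by
  by_contra hne
  have h : ∀ i, q i ≠ r i := fun i hi => hne (hq.eq_of_eq hr hi)
  cases h0 : q 0 with
  | true => exact hq' (hq.isExceptional hr h h0)
  | false =>
    refine hr' (hr.isExceptional hq (fun i => (h i).symm) ?_)
    exact Bool.eq_true_of_not_eq_false fun h1 => h 0 (h0.trans h1.symm)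

theorem card_exceptional : (Finset.univ.filter fun s : Fin (n + 1) → Letter =>
    (∀ i, s i = (true, true, true) ∨ s i = (false, false, true)) ∨
      ∀ i, s i = (false, true, false) ∨ s i = (false, false, true)).card + 1 = 2 ^ (n + 2) := by
  have h1 : (Finset.univ.filter fun s : Fin (n + 1) → Letter =>
      (∀ i, s i = (true, true, true) ∨ s i = (false, false, true))) =
      Fintype.piFinset fun _ => {(true, true, true), (false, false, true)} := by
    ext s; simp
  have h2 : (Finset.univ.filter fun s : Fin (n + 1) → Letter =>
      (∀ i, s i = (false, true, false) ∨ s i = (false, false, true))) =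
      Fintype.piFinset fun _ => {(false, true, false), (false, false, true)} := by
    ext s; simp
  have h3 : (Finset.univ.filter fun s : Fin (n + 1) → Letter =>
      (∀ i, s i = (true, true, true) ∨ s i = (false, false, true))) ∩
      (Finset.univ.filter fun s : Fin (n + 1) → Letter =>
      (∀ i, s i = (false, true, false) ∨ s i = (false, false, true))) =
      {fun _ => (false, false, true)} := by
    ext s
    simp only [Finset.mem_inter, Finset.mem_filter, Finset.mem_univ, true_and,
      Finset.mem_singleton]
    refine ⟨fun h => funext fun i => ?_, ?_⟩
    · rcases h.2 i with h2 | h2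
      · rcases h.1 i with h1 | h1 <;> simp [h2] at h1
      · exact h2
    · rintro rfl
      simp
  have h := Finset.card_union_add_card_inter (Finset.univ.filter fun s : Fin (n + 1) → Letter =>
      (∀ i, s i = (true, true, true) ∨ s i = (false, false, true)))
      (Finset.univ.filter fun s : Fin (n + 1) → Letter =>
      (∀ i, s i = (false, true, false) ∨ s i = (false, false, true)))
  rw [h3, Finset.card_singleton, h1, h2, Fintype.card_piFinset, Fintype.card_piFinset, ← h1, ← h2,
    ← Finset.filter_or] at h
  rw [h]
  simp
  ring

theorem card_accepted : (Fintype.card {s : Fin (n + 1) → Letter // Accepted s} : ℤ) =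
    (transfer ^ (n + 1)).trace - 2 ^ (n + 2) + 1 := by
  have h1 : Fintype.card {s : Fin (n + 1) → Letter // Accepted s} =
      (Finset.univ.filter fun x : (Fin (n + 1) → Letter) × (Fin (n + 1) → Bool) =>
        IsRun x.1 x.2 ∧ ¬ IsExceptional x.1 x.2).card := by
    rw [Fintype.card_subtype]
    symm
    refine Finset.card_bij (fun x _ => x.1) ?_ ?_ ?_
    · rintro ⟨s, q⟩ h
      simp only [Finset.mem_filter, Finset.mem_univ, true_and] at h ⊢
      exact ⟨q, h⟩
    · rintro ⟨s, q⟩ h ⟨s', q'⟩ h' rfl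
      simp only [Finset.mem_filter, Finset.mem_univ, true_and] at h h'
      rw [h.1.unique h'.1 h.2 h'.2]
    · intro s h
      simp only [Finset.mem_filter, Finset.mem_univ, true_and] at h
      obtain ⟨q, hq⟩ := h
      exact ⟨(s, q), by simpa using hq, rfl⟩
  have h2 : (Finset.univ.filter fun x : (Fin (n + 1) → Letter) × (Fin (n + 1) → Bool) =>
        IsRun x.1 x.2 ∧ IsExceptional x.1 x.2).card + 1 = 2 ^ (n + 2) := by
    rw [← card_exceptional]
    congr 1
    refine Finset.card_bij (fun x _ => x.1) ?_ ?_ ?_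
    · rintro ⟨s, q⟩ h
      simp only [Finset.mem_filter, Finset.mem_univ, true_and] at h ⊢
      exact h.2.2
    · rintro ⟨s, q⟩ h ⟨s', q'⟩ h' rfl
      simp only [Finset.mem_filter, Finset.mem_univ, true_and] at h h'
      rw [show q = q' from funext fun i => (h.2.1 i).trans (h'.2.1 i).symm]
    · intro s h
      simp only [Finset.mem_filter, Finset.mem_univ, true_and] at h
      refine ⟨(s, fun _ => true), ?_, rfl⟩
      simp only [Finset.mem_filter, Finset.mem_univ, true_and]
      refine ⟨fun i => ?_, fun _ => rfl, h⟩
      rcases h with h | h <;> rcases h i with h | h <;> rw [h] <;> rfl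
  have h3 := card_isRun (n := n)
  rw [← Finset.card_filter_add_card_filter_not (s := Finset.univ.filter
    fun x : (Fin (n + 1) → Letter) × (Fin (n + 1) → Bool) => IsRun x.1 x.2)
    (fun x => IsExceptional x.1 x.2), Finset.filter_filter, Finset.filter_filter] at h3
  rw [h1, ← h3]
  have h2' : ((Finset.univ.filter fun x : (Fin (n + 1) → Letter) × (Fin (n + 1) → Bool) =>
        IsRun x.1 x.2 ∧ IsExceptional x.1 x.2).card : ℤ) + 1 = 2 ^ (n + 2) := by
    exact_mod_cast h2
  push_cast
  linarith

end

section

variable {n : ℕ} {K : Type*} [Field K]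

/-- The monomial `x ^ d` for an exponent `d` given by its binary digits. -/
def mono (x : K) (d : Fin (n + 1) → Bool) : K :=
  ∏ i, if d i then x ^ 2 ^ i.val else 1

/-- The coefficient belonging to a token. -/
def tokVal (a b c : K) : Token → K
  | (false, false, false) => 1
  | (true, false, false) => a
  | (false, true, false) => b
  | (false, false, true) => c
  | (false, true, true) => b * c
  | (true, true, false) => a * b + c ^ 2
  | (true, false, true) => a * c
  | (true, true, true) => a * b * c

theorem sum_tokVal (a b c x : K) (t : Bool × Bool) :
    ∑ w, (expo w t).elim 0 (fun m => tokVal a b c w * x ^ m) =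
      (if t.1 then a * x + c else 1) * (if t.2 then c * x + b else 1) := by
  obtain ⟨ε, η⟩ := t
  simp only [Fintype.sum_prod_type, Fintype.sum_bool]
  cases ε <;> cases η <;> simp [expo, tokVal] <;> ring

theorem tokVal_eq (a b c : K) (α β γ : Bool) : tokVal a b c (α, β, γ) =
    (if α then a else 1) * (if β then b else 1) * (if γ then c else 1) +
      if (α, β, γ) = (true, true, false) then c ^ 2 else 0 := by
  cases α <;> cases β <;> cases γ <;> simp [tokVal]

theorem mono_inter (x : K) (α : Fin (n + 1) → Bool) (J : Finset (Fin (n + 1))) :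
    mono x (fun i => α i && decide (i ∈ J)) = ∏ i ∈ J, if α i then x ^ 2 ^ i.val else 1 := by
  rw [mono, ← Finset.prod_subset (Finset.subset_univ J)]
  · refine Finset.prod_congr rfl fun i hi => ?_
    simp [hi]
  · intro i _ hi
    simp [hi]

theorem Emits.expo_eq : ∀ {w : Token} {s : Letter} {p p' : Bool}, Emits w s p p' →
    ∃ m, expo w s.2 = some m ∧ m + p.toNat = s.1.toNat + 2 * p'.toNat := by
  intro w s p p' h
  simpa [Emits, Option.any_eq_true] using h

variable [Fintype K]

theorem pow_two_pow_succ (hK : Fintype.card K = 2 ^ (n + 1)) (x : K) (i : Fin (n + 1)) :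
    x ^ 2 ^ (i + 1).val = (x ^ 2 ^ i.val) ^ 2 := by
  rw [← pow_mul, ← pow_succ]
  rcases Fin.eq_castSucc_or_eq_last i with ⟨j, rfl⟩ | rfl
  · simp [Fin.coeSucc_eq_succ]
  · rw [Fin.last_add_one, Fin.val_last, ← hK, FiniteField.pow_card]
    simp

theorem prod_pow_eq_mono (hK : Fintype.card K = 2 ^ (n + 1)) (x : K)
    {s : Fin (n + 1) → Letter} {p : Fin (n + 1) → Bool} {m : Fin (n + 1) → ℕ}
    (hm : ∀ i, m i + (p i).toNat = (s i).1.toNat + 2 * (p (i + 1)).toNat)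
    (hp : ¬ ((∀ i, (s i).1 = false) ∧ ∀ i, p i = true)) :
    ∏ i, (x ^ 2 ^ i.val) ^ m i = mono x fun i => (s i).1 := by
  by_cases hx : x = 0
  · subst hx
    have h0 : ∀ i : Fin (n + 1), (0 : K) ^ 2 ^ i.val = 0 := fun i => zero_pow (by positivity)
    have hiff : (∀ i, m i = 0) ↔ ∀ i, (s i).1 = false := by
      constructor
      · intro h
        have hp' : ∀ i, p (i + 1) = false := fun i => by
          have := hm i
          rw [h] at this
          cases hpi : p (i + 1)
          · rfl
          · have := Bool.toNat_le (p i)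
            simp_all
        intro i
        have := hm i
        have h2 := hp' (i - 1)
        rw [sub_add_cancel] at h2
        rw [h, hp', h2] at this
        simpa using this.symm
      · intro h
        have hp' : ∀ i, p i = false := by
          intro j
          by_contra hj
          rw [Bool.not_eq_false] at hj
          refine hp ⟨h, cyclic_induction (P := fun i => p i = true) j hj fun i hi => ?_⟩
          have := hm i
          rw [h, hi] at this
          cases hpi : p (i + 1)
          · simp [hpi] at this
          · rfl
        intro i
        have := hm i
        simpa [h, hp'] using this
    have hl : ∏ i : Fin (n + 1), ((0 : K) ^ 2 ^ i.val) ^ m i = if ∀ i, m i = 0 then 1 else 0 := by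
      simp only [h0]
      split_ifs with h
      · simp [h]
      · push Not at h
        obtain ⟨i, hi⟩ := h
        exact Finset.prod_eq_zero (Finset.mem_univ i) (zero_pow hi)
    have hr : mono (0 : K) (fun i => (s i).1) = if ∀ i, (s i).1 = false then 1 else 0 := by
      simp only [mono, h0]
      split_ifs with h
      · simp [h]
      · push Not at h
        obtain ⟨i, hi⟩ := h
        exact Finset.prod_eq_zero (Finset.mem_univ i) (by simpa using hi)
    rw [hl, hr]
    simp only [hiff]
  · have hne : ∏ i, (x ^ 2 ^ i.val) ^ (p i).toNat ≠ 0 :=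
      Finset.prod_ne_zero_iff.2 fun i _ => pow_ne_zero _ (pow_ne_zero _ hx)
    refine mul_right_cancel₀ hne ?_
    rw [← Finset.prod_mul_distrib]
    simp only [← pow_add, hm]
    simp only [pow_add, pow_mul, ← pow_two_pow_succ hK, Finset.prod_mul_distrib]
    congr 1
    · refine Finset.prod_congr rfl fun i _ => ?_
      cases h : (s i).1 <;> simp [h]
    · exact Equiv.prod_comp (Equiv.addRight (1 : Fin (n + 1)))
        fun i => (x ^ 2 ^ i.val) ^ (p i).toNat

theorem prod_expo_eq (hK : Fintype.card K = 2 ^ (n + 1)) (x : K) (A : Fin (n + 1) → K)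
    (w : Fin (n + 1) → Token) (t : Fin (n + 1) → Bool × Bool) :
    ∏ i, (expo (w i) (t i)).elim 0 (fun m => A i * (x ^ 2 ^ i.val) ^ m) =
      ∑ d, (∏ i, A i) * prodMatrix K n w (fun i => (d i, t i)) * mono x d := by
  by_cases h : ∀ i, (expo (w i) (t i)).isSome
  · obtain ⟨d, hd⟩ := exists_produces h
    rw [Finset.sum_eq_single d]
    · have hd' := hd
      obtain ⟨p, hp, hp0⟩ := hd'
      choose m hm hm' using fun i => Emits.expo_eq (hp i)
      dsimp only at hm
      simp only [hm, Option.elim_some, Finset.prod_mul_distrib]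
      rw [prod_pow_eq_mono hK x hm' hp0]
      simp [prodMatrix, hd]
    · intro d' _ hne
      rw [prodMatrix, Matrix.of_apply, if_neg, mul_zero, zero_mul]
      intro hd'
      refine hne (funext fun i => ?_)
      exact congrArg Prod.fst (congrFun (hd'.unique hd fun i => rfl) i)
    · simp
  · push Not at h
    obtain ⟨i, hi⟩ := h
    rw [ne_eq, Option.not_isSome_iff_eq_none] at hi
    rw [Finset.prod_eq_zero (Finset.mem_univ i) (by simp [hi]), Finset.sum_eq_zero]
    intro d _
    rw [prodMatrix, Matrix.of_apply, if_neg, mul_zero, zero_mul]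
    rintro ⟨p, hp, -⟩
    obtain ⟨m, hm, -⟩ := Emits.expo_eq (hp i)
    simp [hi] at hm

variable [CharP K 2]

theorem mono_mul_mono (hK : Fintype.card K = 2 ^ (n + 1)) (a b c x : K)
    (ε η : Fin (n + 1) → Bool) :
    mono (a * x + c) ε * mono (c * x + b) η =
      ∑ w : Fin (n + 1) → Token, ∑ d,
        (∏ i : Fin (n + 1), tokVal (a ^ 2 ^ i.val) (b ^ 2 ^ i.val) (c ^ 2 ^ i.val) (w i)) *
          prodMatrix K n w (fun i => (d i, ε i, η i)) * mono x d := by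
  simp only [← prod_expo_eq hK x _ _ fun i => (ε i, η i)]
  rw [mono, mono, ← Finset.prod_mul_distrib, ← Fintype.piFinset_univ,
    ← Finset.prod_univ_sum (fun _ => Finset.univ) fun i w => (expo w (ε i, η i)).elim 0 fun m =>
      tokVal (a ^ 2 ^ i.val) (b ^ 2 ^ i.val) (c ^ 2 ^ i.val) w * (x ^ 2 ^ i.val) ^ m]
  refine Finset.prod_congr rfl fun i _ => ?_
  rw [sum_tokVal, add_pow_char_pow, add_pow_char_pow, mul_pow, mul_pow]

/-- The coefficients of the indicator function of `z` with respect to the monomials. -/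
def deltaCoeff (ε : Fin (n + 1) → Bool) (z : K) : K :=
  (if ∀ i, ε i = false then 1 else 0) + ∏ i, if ε i then 1 else z ^ 2 ^ i.val

theorem sum_mono_mul_deltaCoeff (hK : Fintype.card K = 2 ^ (n + 1)) (u z : K) :
    ∑ ε : Fin (n + 1) → Bool, mono u ε * deltaCoeff ε z = if u = z then 1 else 0 := by
  have h1 : ∑ ε : Fin (n + 1) → Bool, mono u ε * (if ∀ i, ε i = false then 1 else 0) = 1 := by
    rw [Finset.sum_eq_single fun _ => false]
    · simp [mono]
    · intro ε _ hε
      rw [if_neg, mul_zero]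
      exact fun h => hε (funext h)
    · simp
  have h2 : ∑ ε : Fin (n + 1) → Bool, mono u ε * (∏ i, if ε i then 1 else z ^ 2 ^ i.val) =
      (u + z) ^ (Fintype.card K - 1) := by
    have : Fintype.card K - 1 = ∑ i : Fin (n + 1), 2 ^ i.val := by
      rw [Fin.sum_univ_eq_sum_range (fun i => 2 ^ i), hK, Nat.geomSum_eq le_rfl]
      simp
    rw [this, ← Finset.prod_pow_eq_pow_sum]
    simp only [add_pow_char_pow]
    have h3 : ∀ i : Fin (n + 1), u ^ 2 ^ i.val + z ^ 2 ^ i.val =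
        ∑ e : Bool, (if e then u ^ 2 ^ i.val else 1) * (if e then 1 else z ^ 2 ^ i.val) := by
      intro i
      simp
    simp only [h3]
    rw [Finset.prod_univ_sum, Fintype.piFinset_univ]
    simp only [mono, Finset.prod_mul_distrib]
  simp only [deltaCoeff, mul_add, Finset.sum_add_distrib]
  rw [h1, h2]
  split_ifs with h
  · rw [h, CharTwo.add_self_eq_zero, zero_pow, add_zero]
    rw [hK, pow_succ]
    have := Nat.one_le_two_pow (n := n)
    omega
  · rw [FiniteField.pow_card_sub_one_eq_one, CharTwo.add_self_eq_zero]
    rwa [Ne, CharTwo.add_eq_zero]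

end

section

variable {n : ℕ} {K : Type*} [Field K] [Fintype K] [CharP K 2]

theorem sum_deltaCoeff_mul_mono (hK : Fintype.card K = 2 ^ (n + 1)) (ε η : Fin (n + 1) → Bool) :
    ∑ z : K, deltaCoeff ε z * mono z η = if ε = η then 1 else 0 := by
  have h : (Matrix.of fun (u : K) (ε : Fin (n + 1) → Bool) => mono u ε) *
      (Matrix.of fun (ε : Fin (n + 1) → Bool) (z : K) => deltaCoeff ε z) = 1 := by
    ext u z
    rw [Matrix.mul_apply, Matrix.one_apply, ← sum_mono_mul_deltaCoeff hK u z]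
    rfl
  rw [Matrix.mul_eq_one_comm_of_card_eq _ _ _ (by simp [hK])] at h
  have := congrFun (congrFun h ε) η
  rw [Matrix.mul_apply, Matrix.one_apply] at this
  exact this

/-- The incidence matrix in coordinates where it is
`z = a x + c` and `w = c x + b`. -/
def symMatrix (K : Type*) [Field K] : Matrix (K × K × K) (K × K × K) K :=
  Matrix.of fun r p => if r.1 * p.1 + r.2.2 = p.2.2 ∧ r.2.2 * p.1 + r.2.1 = p.2.1 then 1 else 0

/-- The words evaluated at lines. -/
def wordMatrix (K : Type*) [Field K] (n : ℕ) : Matrix (K × K × K) (Fin (n + 1) → Token) K :=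
  Matrix.of fun r w =>
    ∏ i : Fin (n + 1), tokVal (r.1 ^ 2 ^ i.val) (r.2.1 ^ 2 ^ i.val) (r.2.2 ^ 2 ^ i.val) (w i)

/-- The strings evaluated at points. -/
def stringMatrix (K : Type*) [Field K] (n : ℕ) : Matrix (Fin (n + 1) → Letter) (K × K × K) K :=
  Matrix.of fun s p => mono p.1 (fun i => (s i).1) * deltaCoeff (fun i => (s i).2.1) p.2.2 *
    deltaCoeff (fun i => (s i).2.2) p.2.1

/-- A string as a triple of bit strings. -/
def stringEquiv (n : ℕ) : (Fin (n + 1) → Letter) ≃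
    (Fin (n + 1) → Bool) × (Fin (n + 1) → Bool) × (Fin (n + 1) → Bool) where
  toFun s := (fun i => (s i).1, fun i => (s i).2.1, fun i => (s i).2.2)
  invFun d i := (d.1 i, d.2.1 i, d.2.2 i)
  left_inv _ := rfl
  right_inv _ := rfl

theorem symMatrix_eq (hK : Fintype.card K = 2 ^ (n + 1)) :
    symMatrix K = wordMatrix K n * prodMatrix K n * stringMatrix K n := by
  ext ⟨a, b, c⟩ ⟨x, w, z⟩
  have h1 : symMatrix K (a, b, c) (x, w, z) = (∑ ε : Fin (n + 1) → Bool,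
      mono (a * x + c) ε * deltaCoeff ε z) *
      ∑ η : Fin (n + 1) → Bool, mono (c * x + b) η * deltaCoeff η w := by
    rw [sum_mono_mul_deltaCoeff hK, sum_mono_mul_deltaCoeff hK, symMatrix, Matrix.of_apply,
      ite_zero_mul_ite_zero, one_mul]
  rw [h1, Matrix.mul_apply, ← (stringEquiv n).symm.sum_comp, Fintype.sum_prod_type,
    Finset.sum_comm, Fintype.sum_prod_type, Finset.sum_mul_sum]
  refine Finset.sum_congr rfl fun ε _ => Finset.sum_congr rfl fun η _ => ?_
  calc _ = mono (a * x + c) ε * mono (c * x + b) η * (deltaCoeff ε z * deltaCoeff η w) := by ring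
    _ = _ := by
      rw [mono_mul_mono hK, Finset.sum_comm, Finset.sum_mul]
      refine Finset.sum_congr rfl fun d _ => ?_
      rw [Matrix.mul_apply, Finset.sum_mul, Finset.sum_mul]
      refine Finset.sum_congr rfl fun w _ => ?_
      simp only [stringMatrix, stringEquiv, wordMatrix, Matrix.of_apply, Equiv.coe_fn_symm_mk]
      ring

/-- The inverse of `stringMatrix`. -/
def stringInv (K : Type*) [Field K] (n : ℕ) : Matrix (K × K × K) (Fin (n + 1) → Letter) K :=
  Matrix.of fun p s => deltaCoeff (fun i => (s i).1) p.1 *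
    mono p.2.2 (fun i => (s i).2.1) * mono p.2.1 fun i => (s i).2.2

theorem stringMatrix_mul_stringInv (hK : Fintype.card K = 2 ^ (n + 1)) :
    stringMatrix K n * stringInv K n = 1 := by
  ext s r
  rw [Matrix.mul_apply, Fintype.sum_prod_type]
  simp only [Fintype.sum_prod_type]
  have h : ∀ x w z : K, stringMatrix K n s (x, w, z) * stringInv K n (x, w, z) r =
      (deltaCoeff (fun i => (r i).1) x * mono x fun i => (s i).1) *
      ((deltaCoeff (fun i => (s i).2.2) w * mono w fun i => (r i).2.2) *
      (deltaCoeff (fun i => (s i).2.1) z * mono z fun i => (r i).2.1)) := by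
    intro x w z
    simp only [stringMatrix, stringInv, Matrix.of_apply]
    ring
  simp only [h, ← Finset.mul_sum, ← Finset.sum_mul, sum_deltaCoeff_mul_mono hK]
  rw [Matrix.one_apply]
  by_cases hsr : s = r
  · simp [hsr]
  · rw [if_neg hsr]
    by_contra hne
    simp only [mul_ite, mul_one, mul_zero, ite_eq_right_iff, one_ne_zero, imp_false, not_forall,
      not_not] at hne
    obtain ⟨h1, h2, h3⟩ := hne
    refine hsr (funext fun i => ?_)
    simp only [Prod.ext_iff]
    simp_all [funext_iff]

end

section

variable {n : ℕ} {K : Type*} [Field K] [Fintype K] [CharP K 2]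

theorem eq_sum_mono (hK : Fintype.card K = 2 ^ (n + 1)) (g : K → K) (u : K) :
    g u = ∑ z, ∑ ε : Fin (n + 1) → Bool, deltaCoeff ε z * g z * mono u ε := by
  have h : ∀ z, ∑ ε : Fin (n + 1) → Bool, deltaCoeff ε z * g z * mono u ε =
      if u = z then g z else 0 := by
    intro z
    rw [← one_mul (g z), ← zero_mul (g z), ← ite_mul, ← sum_mono_mul_deltaCoeff hK u z,
      Finset.sum_mul]
    exact Finset.sum_congr rfl fun ε _ => by ring
  simp [h]

theorem mono_mem_range (hK : Fintype.card K = 2 ^ (n + 1)) (m : ℕ) :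
    ∀ (α β : Fin (n + 1) → Bool) (g : K → K), (Finset.univ.filter fun i => α i = true).card = m →
      (fun r : K × K × K => mono r.1 α * mono r.2.1 β * g r.2.2) ∈
        LinearMap.range (wordMatrix K n).mulVecLin := by
  induction m using Nat.strong_induction_on with
  | _ m ih =>
    intro α β g hm
    suffices h : ∀ γ : Fin (n + 1) → Bool,
        (fun r : K × K × K => mono r.1 α * mono r.2.1 β * mono r.2.2 γ) ∈
          LinearMap.range (wordMatrix K n).mulVecLin by
      have : (fun r : K × K × K => mono r.1 α * mono r.2.1 β * g r.2.2) =
          ∑ z, ∑ γ : Fin (n + 1) → Bool, (deltaCoeff γ z * g z) •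
            fun r : K × K × K => mono r.1 α * mono r.2.1 β * mono r.2.2 γ := by
        ext r
        rw [eq_sum_mono hK g r.2.2, Finset.mul_sum, Finset.sum_apply]
        refine Finset.sum_congr rfl fun z _ => ?_
        rw [Finset.mul_sum, Finset.sum_apply]
        refine Finset.sum_congr rfl fun γ _ => ?_
        rw [Pi.smul_apply, smul_eq_mul]
        ring
      rw [this]
      exact Submodule.sum_mem _ fun z _ => Submodule.sum_mem _ fun γ _ =>
        Submodule.smul_mem _ _ (h γ)
    intro γ
    have hcol : (fun r => wordMatrix K n r fun i => (α i, β i, γ i)) ∈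
        LinearMap.range (wordMatrix K n).mulVecLin := by
      refine ⟨Pi.single (fun i => (α i, β i, γ i)) 1, ?_⟩
      ext r
      simp
    let G : Finset (Fin (n + 1)) → K → K := fun J c =>
      (∏ i ∈ J, if γ i then c ^ 2 ^ i.val else 1) * ∏ i ∈ Finset.univ \ J,
        if (α i, β i, γ i) = (true, true, false) then (c ^ 2 ^ i.val) ^ 2 else 0
    have hexp : (fun r => wordMatrix K n r fun i => (α i, β i, γ i)) =
        ∑ J ∈ Finset.univ.powerset, fun r : K × K × K =>
          mono r.1 (fun i => α i && decide (i ∈ J)) * mono r.2.1 (fun i => β i && decide (i ∈ J)) *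
            G J r.2.2 := by
      ext r
      simp only [wordMatrix, Matrix.of_apply, tokVal_eq, Finset.prod_add, Finset.sum_apply]
      refine Finset.sum_congr rfl fun J _ => ?_
      rw [mono_inter, mono_inter, Finset.prod_mul_distrib, Finset.prod_mul_distrib]
      simp only [G]
      ring
    rw [← Finset.add_sum_erase _ _ (Finset.mem_powerset_self Finset.univ), ← sub_eq_iff_eq_add]
      at hexp
    have hlead : (fun r : K × K × K => mono r.1 α * mono r.2.1 β * mono r.2.2 γ) =
        fun r : K × K × K => mono r.1 (fun i => α i && decide (i ∈ Finset.univ)) *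
          mono r.2.1 (fun i => β i && decide (i ∈ Finset.univ)) * G Finset.univ r.2.2 := by
      simp [G, mono]
    rw [hlead, ← hexp]
    refine Submodule.sub_mem _ hcol (Submodule.sum_mem _ fun J hJ => ?_)
    obtain ⟨j, hj⟩ : ∃ j, j ∉ J := by
      by_contra hno
      push Not at hno
      exact (Finset.mem_erase.1 hJ).1 (Finset.eq_univ_of_forall hno)
    by_cases hα : α j = true
    · refine ih _ ?_ _ _ _ rfl
      rw [← hm]
      refine Finset.card_lt_card (Finset.ssubset_iff_of_subset ?_ |>.2
        ⟨j, by simpa using hα, by simp [hj]⟩)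
      intro i
      simp only [Finset.mem_filter, Finset.mem_univ, true_and, Bool.and_eq_true]
      exact And.left
    · have hG : ∀ c, G J c = 0 := fun c =>
        mul_eq_zero_of_right _ (Finset.prod_eq_zero (i := j) (by simpa using hj)
          (by simp [hα]))
      simp only [hG, mul_zero]
      exact Submodule.zero_mem _

theorem wordMatrix_mulVec_surjective (hK : Fintype.card K = 2 ^ (n + 1)) :
    Function.Surjective (wordMatrix K n).mulVec := by
  intro f
  have : f = ∑ a, ∑ α : Fin (n + 1) → Bool, ∑ b, ∑ β : Fin (n + 1) → Bool,
      (deltaCoeff α a * deltaCoeff β b) •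
        fun r : K × K × K => mono r.1 α * mono r.2.1 β * f (a, b, r.2.2) := by
    ext ⟨x, y, z⟩
    rw [eq_sum_mono hK (fun u => f (u, y, z)) x, Finset.sum_apply]
    refine Finset.sum_congr rfl fun a _ => ?_
    rw [Finset.sum_apply]
    refine Finset.sum_congr rfl fun α _ => ?_
    rw [eq_sum_mono hK (fun u => f (a, u, z)) y, Finset.sum_apply, Finset.mul_sum, Finset.sum_mul]
    refine Finset.sum_congr rfl fun b _ => ?_
    rw [Finset.sum_apply, Finset.mul_sum, Finset.sum_mul]
    refine Finset.sum_congr rfl fun β _ => ?_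
    rw [Pi.smul_apply, smul_eq_mul]
    ring
  have hmem : f ∈ LinearMap.range (wordMatrix K n).mulVecLin := by
    rw [this]
    exact Submodule.sum_mem _ fun a _ => Submodule.sum_mem _ fun α _ => Submodule.sum_mem _
      fun b _ => Submodule.sum_mem _ fun β _ => Submodule.smul_mem _ _
        (mono_mem_range hK _ α β (fun c => f (a, b, c)) rfl)
  exact hmem

theorem card_triples {K : Type*} [Fintype K] (hK : Fintype.card K = 2 ^ (n + 1)) :
    Fintype.card (K × K × K) = Fintype.card (Fin (n + 1) → Token) := by
  have h : 8 ^ n = 2 ^ (n * 3) := by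
    rw [mul_comm, pow_mul]
    norm_num
  simp [hK, pow_succ, h]
  ring

theorem rank_symMatrix (hK : Fintype.card K = 2 ^ (n + 1)) :
    (symMatrix K).rank = (prodMatrix K n).rank := by
  obtain ⟨A', hA⟩ := Matrix.mulVec_surjective_iff_exists_right_inverse.1
    (wordMatrix_mulVec_surjective hK)
  rw [Matrix.mul_eq_one_comm_of_card_eq _ _ _ (card_triples hK)] at hA
  refine le_antisymm ?_ ?_
  · rw [symMatrix_eq hK]
    exact (Matrix.rank_mul_le_left _ _).trans (Matrix.rank_mul_le_right _ _)
  · have : prodMatrix K n = A' * symMatrix K * stringInv K n := by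
      rw [symMatrix_eq hK, Matrix.mul_assoc, Matrix.mul_assoc, stringMatrix_mul_stringInv hK,
        Matrix.mul_one, ← Matrix.mul_assoc, hA, Matrix.one_mul]
    rw [this]
    exact (Matrix.rank_mul_le_left _ _).trans (Matrix.rank_mul_le_right _ _)

theorem rank_map_eq {ι F L : Type*} [Fintype ι] [Field F] [Field L] (f : F →+* L)
    (A : Matrix ι ι F) : (A.map f).rank = A.rank := by
  obtain ⟨P, Q, D, rfl⟩ := Matrix.Pivot.exists_list_transvec_mul_diagonal_mul_list_transvec A
  have hP := Matrix.TransvectionStruct.det_toMatrix_prod P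
  have hQ := Matrix.TransvectionStruct.det_toMatrix_prod Q
  have hP' : ((P.map Matrix.TransvectionStruct.toMatrix).prod.map f).det = 1 := by
    rw [← RingHom.mapMatrix_apply, ← RingHom.map_det, hP, map_one]
  have hQ' : ((Q.map Matrix.TransvectionStruct.toMatrix).prod.map f).det = 1 := by
    rw [← RingHom.mapMatrix_apply, ← RingHom.map_det, hQ, map_one]
  rw [Matrix.map_mul, Matrix.map_mul, Matrix.rank_mul_eq_left_of_isUnit_det _ _ (by simp [hQ']),
    Matrix.rank_mul_eq_right_of_isUnit_det _ _ (by simp [hP']),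
    Matrix.rank_mul_eq_left_of_isUnit_det _ _ (by simp [hQ]),
    Matrix.rank_mul_eq_right_of_isUnit_det _ _ (by simp [hP]),
    Matrix.diagonal_map (map_zero f), Matrix.rank_diagonal, Matrix.rank_diagonal]
  simp

end

section

variable {K : Type*} [Field K] [Fintype K] [CharP K 2]

/-- Coordinates for lines in which the incidence relation is symmetric. -/
def lineMap (r : K × K × K) : K × K × K :=
  (r.1, r.2.1, r.2.2 ^ 2 + r.1 * r.2.1)

/-- Coordinates for points in which the incidence relation is symmetric. -/
def pointMap (p : K × K × K) : K × K × K :=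
  (p.1 ^ 2, p.2.1 + p.1 * p.2.2, p.2.2 ^ 2)

theorem sq_injective {K : Type*} [Field K] [CharP K 2] : Function.Injective fun x : K => x ^ 2 :=
  frobenius_inj K 2

theorem lineMap_bijective : Function.Bijective (lineMap (K := K)) := by
  refine Finite.injective_iff_bijective.1 ?_
  rintro ⟨a, b, c⟩ ⟨a', b', c'⟩ h
  simp only [lineMap, Prod.mk.injEq] at h
  obtain ⟨rfl, rfl, h⟩ := h
  rw [sq_injective (add_right_cancel h : c ^ 2 = c' ^ 2)]

theorem pointMap_bijective : Function.Bijective (pointMap (K := K)) := by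
  refine Finite.injective_iff_bijective.1 ?_
  rintro ⟨x, w, z⟩ ⟨x', w', z'⟩ h
  simp only [pointMap, Prod.mk.injEq] at h
  obtain ⟨hx, h, hz⟩ := h
  obtain rfl : x = x' := sq_injective hx
  obtain rfl : z = z' := sq_injective hz
  rw [add_right_cancel h]

theorem incidence_iff {K : Type*} [Field K] [CharP K 2] (a b c x w z : K) :
    (w + x * z = a * x ^ 2 + b ∧ z ^ 2 = a * (w + x * z) + (c ^ 2 + a * b)) ↔
      a * x + c = z ∧ c * x + b = w := by
  have h2 : (2 : K) = 0 := CharTwo.two_eq_zero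
  constructor
  · rintro ⟨h1, h⟩
    have hz : a * x + c = z := by
      refine sq_injective ?_
      simp only
      linear_combination -h - a * h1 + (a * x * c - a * b) * h2
    refine ⟨hz, ?_⟩
    linear_combination -h1 + x * hz + (x * z - x ^ 2 * a) * h2
  · rintro ⟨rfl, rfl⟩
    constructor
    · linear_combination c * x * h2
    · linear_combination -a * b * h2

end

theorem H3_map_submatrix [CharP k 2] :
    ((H3 k).map (ZMod.castHom (dvd_refl 2) k)).submatrix
      (Equiv.ofBijective _ (lineMap_bijective (K := k)))
      (Equiv.ofBijective _ (pointMap_bijective (K := k))) = symMatrix k := by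
  ext ⟨a, b, c⟩ ⟨x, w, z⟩
  have h := incidence_iff a b c x w z
  simp only [Matrix.submatrix_apply, Matrix.map_apply, H3, symMatrix, Equiv.ofBijective_apply,
    lineMap, pointMap, h]
  split_ifs with hc <;> simpa using hc

theorem rank_H3 [CharP k 2] : (H3 k).rank = (symMatrix k).rank := by
  rw [← H3_map_submatrix, Matrix.rank_submatrix, rank_map_eq]

theorem finrank_LUcode :
    Module.finrank (ZMod 2) (LUcode k) + (H3 k).rank = Fintype.card k ^ 3 := by
  have h := LinearMap.finrank_range_add_finrank_ker (H3 k).mulVecLin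
  rw [Module.finrank_fintype_fun_eq_card, Fintype.card_prod, Fintype.card_prod] at h
  rw [add_comm, LUcode, Matrix.rank, h]
  ring

end LU3

theorem dim_LU (t : ℕ) (ht : 0 < t) (q : ℕ) (hq : q = 2 ^ t)
    (hcard : Fintype.card k = q) :
    (Module.finrank (ZMod 2) (LUcode k) : ℝ) =
      2 ^ (3 * t) + 2 ^ (t + 1) - 1 - ((1 + Real.sqrt 17) / 2) ^ (2 * t)
        - ((1 - Real.sqrt 17) / 2) ^ (2 * t) := by
  obtain ⟨n, rfl⟩ := Nat.exists_eq_succ_of_ne_zero ht.ne'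
  subst hq
  have : CharP k 2 := charP_of_card_eq_prime_pow hcard
  have hrank : ((H3 k).rank : ℤ) = (LU3.transfer ^ (n + 1)).trace - 2 ^ (n + 2) + 1 := by
    rw [LU3.rank_H3, LU3.rank_symMatrix hcard, LU3.rank_prodMatrix, LU3.card_accepted]
  have hrank' := congrArg (Int.cast : ℤ → ℝ) hrank
  push_cast [LU3.trace_transfer_pow] at hrank'
  have hdim := congrArg (Nat.cast : ℕ → ℝ) (LU3.finrank_LUcode k)
  rw [hcard] at hdim
  push_cast at hdim
  rw [← pow_mul, mul_comm n.succ 3] at hdim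
  simp only [Nat.succ_eq_add_one] at hdim ⊢
  linear_combination hdim - hrank'
end
end

section
/- Let q be any prime power. The set X0 ∪ Y ∪ Z is linearly independent over F_2 in the space F_2[P] of F_2-valued functions on P. -/
open Submodule Module
open scoped Classical

noncomputable section

variable (k : Type) [Field k] [Fintype k]

/-- The nonsingular alternating bilinear form on `k^4`. -/
def B (u v : Fin 4 → k) : k := u 0 * v 3 - u 3 * v 0 + u 1 * v 2 - u 2 * v 1

/-- Points of the projective space: 1-dimensional subspaces of `k^4`. -/
def IsPt (p : Submodule k (Fin 4 → k)) : Prop := finrank k p = 1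

/-- Lines: totally isotropic 2-dimensional subspaces of `k^4`. -/
def IsLn (l : Submodule k (Fin 4 → k)) : Prop :=
  finrank k l = 2 ∧ ∀ u ∈ l, ∀ v ∈ l, B k u v = 0

/-- The point set `P`. -/
abbrev Pt := {p : Submodule k (Fin 4 → k) // IsPt k p}

def e (i : Fin 4) : Fin 4 → k := Pi.single i 1

/-- The fixed point `p0 = span{e0}`. -/
def p0 : Submodule k (Fin 4 → k) := span k {e k 0}

/-- The fixed line `ℓ0 = span{e0, e1}`. -/
def l0 : Submodule k (Fin 4 → k) := span k {e k 0, e k 1}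

/-- Membership in `P1`: points `span{v}` with `B(e0, v) ≠ 0`. -/
def InP1 (p : Pt k) : Prop := ∃ v ∈ (p : Submodule k (Fin 4 → k)), B k (e k 0) v ≠ 0

/-- The characteristic function of a line, as an `F_2`-valued function on `P`. -/
def chi (l : Submodule k (Fin 4 → k)) : Pt k → ZMod 2 :=
  fun p => if (p : Submodule k (Fin 4 → k)) ≤ l then 1 else 0

/-- The set `L1` of lines meeting `ℓ0` only in `0`. -/
def L1 : Set (Submodule k (Fin 4 → k)) := {l | IsLn k l ∧ l ⊓ l0 k = ⊥}

/-- The code `C(P,L)`. -/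
def CPL : Submodule (ZMod 2) (Pt k → ZMod 2) := span (ZMod 2) (chi k '' {l | IsLn k l})

/-- The code `C(P,L1)`. -/
def CPL1 : Submodule (ZMod 2) (Pt k → ZMod 2) := span (ZMod 2) (chi k '' L1 k)

/-- Restriction of functions on `P` to `P1`. -/
def piP1 : (Pt k → ZMod 2) →ₗ[ZMod 2] ({p : Pt k // InP1 k p} → ZMod 2) :=
  LinearMap.funLeft (ZMod 2) (ZMod 2) Subtype.val

/-- The code `C(P1,L1)`, the image of `C(P,L1)` under restriction to `P1`. -/
def CP1L1 : Submodule (ZMod 2) ({p : Pt k // InP1 k p} → ZMod 2) := (CPL1 k).map (piP1 k)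

/-- `X0`: the characteristic functions of the lines through `p0`, except `χ_{ℓ0}`. -/
def X0 : Set (Pt k → ZMod 2) :=
  (chi k '' {l | IsLn k l ∧ p0 k ≤ l}) \ {chi k (l0 k)}

theorem linearIndepOn_union_of_separating {K α : Type*} [Field K] {W Y : Set (α → K)}
    (hW : LinearIndepOn K id W)
    (h : ∀ y ∈ Y, ∃ a, y a ≠ 0 ∧ ∀ w ∈ W ∪ Y, w ≠ y → w a = 0) :
    LinearIndepOn K id (W ∪ Y) := by
  rw [linearIndepOn_iff] at hW ⊢
  intro l hl hsum
  rw [Finsupp.mem_supported] at hl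
  refine hW l ?_ hsum
  rw [Finsupp.mem_supported]
  intro v hv
  refine (hl hv).resolve_right fun hvY => ?_
  obtain ⟨a, hva, hsep⟩ := h v hvY
  have heval := congrFun hsum a
  rw [Finsupp.linearCombination_apply, Finsupp.sum, Finset.sum_apply,
    Finset.sum_eq_single_of_mem v hv fun w hw hwv => by simp [hsep w (hl hw) hwv]] at heval
  exact (mul_ne_zero (Finsupp.mem_support_iff.mp hv) hva) heval

section
variable {F : Type} [Field F]

theorem finrank_p0 : finrank F (p0 F) = 1 :=
  finrank_span_singleton (by simp [e])

theorem finrank_l0_le : finrank F (l0 F) ≤ 2 := by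
  have h := finrank_span_finset_le_card (R := F) ({e F 0, e F 1} : Finset _)
  rw [Finset.coe_pair] at h
  exact h.trans Finset.card_le_two

theorem p0_le_l0 : p0 F ≤ l0 F :=
  span_mono (by simp)

theorem sup_eq_of_points_le {p p' l : Submodule F (Fin 4 → F)} (hp : IsPt F p) (hp' : IsPt F p')
    (hne : p ≠ p') (hl : finrank F l ≤ 2) (hpl : p ≤ l) (hpl' : p' ≤ l) : p ⊔ p' = l := by
  refine eq_of_le_of_finrank_le (sup_le hpl hpl') (hl.trans ?_)
  have hlt : p < p ⊔ p' := lt_of_le_of_ne le_sup_left fun h =>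
    hne (eq_of_le_of_finrank_eq (h ▸ le_sup_right) (hp'.trans hp.symm)).symm
  have := finrank_lt_finrank_of_lt hlt
  unfold IsPt at hp
  omega

theorem eq_of_points_le {p p' l l' : Submodule F (Fin 4 → F)} (hp : IsPt F p) (hp' : IsPt F p')
    (hne : p ≠ p') (hl : finrank F l ≤ 2) (hl' : finrank F l' ≤ 2) (hpl : p ≤ l) (hpl' : p' ≤ l)
    (hpm : p ≤ l') (hpm' : p' ≤ l') : l = l' :=
  (sup_eq_of_points_le hp hp' hne hl hpl hpl').symm.trans
    (sup_eq_of_points_le hp hp' hne hl' hpm hpm')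

theorem exists_point_ne_p0 {l : Submodule F (Fin 4 → F)} (hl : IsLn F l) :
    ∃ p : Pt F, (p : Submodule F (Fin 4 → F)) ≤ l ∧ (p : Submodule F (Fin 4 → F)) ≠ p0 F := by
  have hnle : ¬ l ≤ p0 F := fun h => by
    have := finrank_mono h
    rw [hl.1, finrank_p0] at this
    omega
  obtain ⟨v, hvl, hv⟩ := SetLike.not_le_iff_exists.mp hnle
  have hv0 : v ≠ 0 := fun h => hv (h ▸ zero_mem _)
  exact ⟨⟨span F {v}, finrank_span_singleton hv0⟩, by simpa using hvl,
    fun h => hv (h ▸ mem_span_singleton_self v)⟩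

theorem chi_of_le {l : Submodule F (Fin 4 → F)} {p : Pt F}
    (h : (p : Submodule F (Fin 4 → F)) ≤ l) : chi F l p = 1 := if_pos h

theorem chi_of_not_le {l : Submodule F (Fin 4 → F)} {p : Pt F}
    (h : ¬ (p : Submodule F (Fin 4 → F)) ≤ l) : chi F l p = 0 := if_neg h

theorem X0_linearIndepOn : LinearIndepOn (ZMod 2) id (X0 F) := by
  rw [← Set.empty_union (X0 F)]
  refine linearIndepOn_union_of_separating (linearIndepOn_empty _ _) ?_
  rintro _ ⟨⟨l, ⟨hl, hpl⟩, rfl⟩, -⟩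
  obtain ⟨p, hp, hne⟩ := exists_point_ne_p0 hl
  refine ⟨p, by simp [chi_of_le hp], ?_⟩
  rw [Set.empty_union]
  rintro _ ⟨⟨m, ⟨hm, hpm⟩, rfl⟩, -⟩ hml
  refine chi_of_not_le fun hpm' => hml ?_
  rw [eq_of_points_le p.2 finrank_p0 hne hm.1.le hl.1.le hpm' hpm hp hpl]

theorem X0_subset_ker : X0 F ⊆ LinearMap.ker (piP1 F) := by
  rintro _ ⟨⟨l, ⟨hl, hpl⟩, rfl⟩, -⟩
  refine LinearMap.mem_ker.mpr (funext ?_)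
  rintro ⟨p, v, hv, hB⟩
  exact chi_of_not_le fun hp => hB (hl.2 _ (hpl (mem_span_singleton_self _)) _ (hp hv))

theorem X0_union_linearIndepOn {Z : Set (Pt F → ZMod 2)}
    (hZ : LinearIndepOn (ZMod 2) (piP1 F) Z) : LinearIndepOn (ZMod 2) id (X0 F ∪ Z) := by
  have hZ' : LinearIndependent (ZMod 2) (piP1 F ∘ ((↑) : Z → Pt F → ZMod 2)) := hZ
  refine X0_linearIndepOn.id_union hZ'.of_comp ?_
  have hdisj := range_ker_disjoint hZ'
  rw [Subtype.range_coe] at hdisj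
  exact (hdisj.mono_right (span_le.mpr X0_subset_ker)).symm

end

theorem X0_Y_Z_linearIndependent (q : ℕ) (hq : Fintype.card k = q)
    -- `Y`: for each point `p ≠ p0` on `ℓ0`, a chosen line `ℓ_p ∈ L \ {ℓ0}` through `p`
    (lsel : Pt k → Submodule k (Fin 4 → k))
    (hsel : ∀ p : Pt k, (p : Submodule k (Fin 4 → k)) ≤ l0 k →
      (p : Submodule k (Fin 4 → k)) ≠ p0 k →
      IsLn k (lsel p) ∧ lsel p ≠ l0 k ∧ (p : Submodule k (Fin 4 → k)) ≤ lsel p)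
    (Y : Set (Pt k → ZMod 2))
    (hY : Y = (fun p => chi k (lsel p)) ''
      {p : Pt k | (p : Submodule k (Fin 4 → k)) ≤ l0 k ∧
        (p : Submodule k (Fin 4 → k)) ≠ p0 k})
    -- `Z`: characteristic functions of lines of `L1` mapped bijectively by `π` to a
    -- basis of `C(P1,L1)`
    (Z : Set (Pt k → ZMod 2)) (hZsub : Z ⊆ chi k '' L1 k)
    (hZinj : Set.InjOn (piP1 k) Z)
    (hZind : LinearIndependent (ZMod 2)
      (fun z : (piP1 k '' Z : Set ({p : Pt k // InP1 k p} → ZMod 2)) =>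
        (z : {p : Pt k // InP1 k p} → ZMod 2)))
    (hZspan : span (ZMod 2) (piP1 k '' Z) = CP1L1 k) :
    LinearIndependent (ZMod 2)
      (fun v : (X0 k ∪ Y ∪ Z : Set (Pt k → ZMod 2)) => (v : Pt k → ZMod 2)) := by
  have hZ : LinearIndepOn (ZMod 2) (piP1 k) Z :=
    (linearIndepOn_iff_image hZinj).mpr hZind
  rw [Set.union_right_comm]
  refine linearIndepOn_union_of_separating (X0_union_linearIndepOn hZ) ?_
  subst hY
  rintro _ ⟨p, ⟨hpl, hp0⟩, rfl⟩
  obtain ⟨-, -, hp⟩ := hsel p hpl hp0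
  refine ⟨p, by simp [chi_of_le hp], ?_⟩
  rintro _ ((⟨⟨m, ⟨hm, hpm⟩, rfl⟩, hml⟩ | hwZ) | ⟨p', ⟨hpl', hp0'⟩, rfl⟩) hne
  · refine chi_of_not_le fun hpm' => hml ?_
    rw [Set.mem_singleton_iff,
      eq_of_points_le p.2 finrank_p0 hp0 hm.1.le finrank_l0_le hpm' hpm hpl p0_le_l0]
  · obtain ⟨m, ⟨-, hm⟩, rfl⟩ := hZsub hwZ
    refine chi_of_not_le fun hpm => ?_
    have hbot : (p : Submodule k (Fin 4 → k)) = ⊥ := le_bot_iff.mp (hm ▸ le_inf hpm hpl)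
    have hrank : finrank k (p : Submodule k (Fin 4 → k)) = 1 := p.2
    rw [hbot, finrank_bot] at hrank
    exact zero_ne_one hrank
  · obtain ⟨hln, hnl0, hp'⟩ := hsel p' hpl' hp0'
    have hpp : (p : Submodule k (Fin 4 → k)) ≠ p' := fun h => hne (by rw [Subtype.ext h])
    exact chi_of_not_le fun hpm => hnl0
      (eq_of_points_le p.2 p'.2 hpp hln.1.le finrank_l0_le hpm hp' hpl hpl')
end
end

section
/- Let q be any prime power. Then dim_{F_2} C(P1,L1) + 2q ≤ dim_{F_2} C(P,L); equivalently, since the LU(3,q) code has dimension q^3 − dim_{F_2} C(P1,L1), one has dim_{F_2} LU(3,q) ≥ q^3 − dim_{F_2} C(P,L) + 2q. -/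
open Submodule Module
open scoped Classical

noncomputable section

variable (k : Type) [Field k] [Fintype k]

set_option linter.unusedSectionVars false

/-- The projective point spanned by a nonzero vector. -/
def ptOf (v : Fin 4 → k) (hv : v ≠ 0) : Pt k := ⟨span k {v}, finrank_span_singleton hv⟩

lemma chi_ptOf (l : Submodule k (Fin 4 → k)) (v : Fin 4 → k) (hv : v ≠ 0) :
    chi k l (ptOf k v hv) = if v ∈ l then 1 else 0 := by
  simp [chi, ptOf]

lemma isLn_span_pair {x y : Fin 4 → k} (hli : LinearIndependent k ![x, y])
    (hB : B k x y = 0) : IsLn k (span k {x, y}) := by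
  refine ⟨?_, fun u hu v hv => ?_⟩
  · rw [← Matrix.range_cons_cons_empty x y ![], finrank_span_eq_card hli, Fintype.card_fin]
  · obtain ⟨a, b, rfl⟩ := mem_span_pair.1 hu
    obtain ⟨c, d, rfl⟩ := mem_span_pair.1 hv
    simp only [B, Pi.add_apply, Pi.smul_apply, smul_eq_mul] at hB ⊢
    linear_combination (a * d - b * c) * hB

/-- The lines through `p0` other than `l0`. -/
def lineThroughP0 (t : k) : Submodule k (Fin 4 → k) :=
  span k {![1, 0, 0, 0], ![0, t, 1, 0]}

/-- A line other than `l0` through the point of `l0` spanned by `![s, 1, 0, 0]`. -/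
def lineMeetingL0 (s : k) : Submodule k (Fin 4 → k) :=
  span k {![s, 1, 0, 0], ![0, 0, -s, 1]}

/-- The lines disjoint from `l0`. -/
def lineOffL0 (c : k × k × k) : Submodule k (Fin 4 → k) :=
  span k {![c.2.1, c.1, 1, 0], ![c.2.2, c.2.1, 0, 1]}

lemma mem_lineThroughP0 (t : k) (v : Fin 4 → k) :
    v ∈ lineThroughP0 k t ↔ v 1 = v 2 * t ∧ v 3 = 0 := by
  rw [lineThroughP0, mem_span_pair]
  constructor
  · rintro ⟨a, b, rfl⟩
    simp
  · rintro ⟨h1, h3⟩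
    refine ⟨v 0, v 2, ?_⟩
    ext i
    fin_cases i <;> simp [h1, h3]

lemma mem_lineMeetingL0 (s : k) (v : Fin 4 → k) :
    v ∈ lineMeetingL0 k s ↔ v 0 = v 1 * s ∧ v 2 = -(v 3 * s) := by
  rw [lineMeetingL0, mem_span_pair]
  constructor
  · rintro ⟨a, b, rfl⟩
    simp
  · rintro ⟨h0, h2⟩
    refine ⟨v 1, v 3, ?_⟩
    ext i
    fin_cases i <;> simp [h0, h2]

lemma mem_lineOffL0 (c : k × k × k) (v : Fin 4 → k) :
    v ∈ lineOffL0 k c ↔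
      v 0 = v 2 * c.2.1 + v 3 * c.2.2 ∧ v 1 = v 2 * c.1 + v 3 * c.2.1 := by
  rw [lineOffL0, mem_span_pair]
  constructor
  · rintro ⟨a, b, rfl⟩
    simp
  · rintro ⟨h0, h1⟩
    refine ⟨v 2, v 3, ?_⟩
    ext i
    fin_cases i <;> simp [h0, h1]

lemma isLn_lineThroughP0 (t : k) : IsLn k (lineThroughP0 k t) := by
  refine isLn_span_pair k (LinearIndependent.pair_iff.2 fun a b h => ?_) (by simp [B])
  exact ⟨by simpa using congrFun h 0, by simpa using congrFun h 2⟩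

lemma isLn_lineMeetingL0 (s : k) : IsLn k (lineMeetingL0 k s) := by
  refine isLn_span_pair k (LinearIndependent.pair_iff.2 fun a b h => ?_) (by simp [B])
  exact ⟨by simpa using congrFun h 1, by simpa using congrFun h 3⟩

lemma mem_l0 (v : Fin 4 → k) : v ∈ l0 k ↔ v 2 = 0 ∧ v 3 = 0 := by
  rw [l0, mem_span_pair]
  constructor
  · rintro ⟨a, b, rfl⟩
    simp [e]
  · rintro ⟨h2, h3⟩
    refine ⟨v 0, v 1, ?_⟩
    ext i
    fin_cases i <;> simp [e, h2, h3]

lemma lineOffL0_mem_L1 (c : k × k × k) : lineOffL0 k c ∈ L1 k := by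
  refine ⟨isLn_span_pair k (LinearIndependent.pair_iff.2 fun a b h => ?_) (by simp [B]), ?_⟩
  · exact ⟨by simpa using congrFun h 2, by simpa using congrFun h 3⟩
  · rw [eq_bot_iff]
    rintro v ⟨hv, hv0⟩
    obtain ⟨h2, h3⟩ := (mem_l0 k v).1 hv0
    obtain ⟨h0, h1⟩ := (mem_lineOffL0 k c v).1 hv
    rw [mem_bot]
    ext i
    fin_cases i <;> simp [h0, h1, h2, h3]

/-- The points of `l0` other than `p0`. -/
def ptOnL0 (s : k) : Pt k :=
  ptOf k ![s, 1, 0, 0] fun h => one_ne_zero (α := k) (by simpa using congrFun h 1)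

/-- A point other than `p0` on each line through `p0` distinct from `l0`. -/
def ptOnPerp (t : k) : Pt k :=
  ptOf k ![0, t, 1, 0] fun h => one_ne_zero (α := k) (by simpa using congrFun h 2)

/-- The points of `P1`, indexed by the rows of `H3`. -/
def ptOfRow (r : k × k × k) : {p : Pt k // InP1 k p} :=
  ⟨ptOf k ![r.2.2, r.2.1, -r.1, 1] fun h => one_ne_zero (α := k) (by simpa using congrFun h 3),
    ![r.2.2, r.2.1, -r.1, 1], mem_span_singleton_self _, by simp [B, e]⟩

lemma CPL1_apply_ptOnL0 {f : Pt k → ZMod 2} (hf : f ∈ CPL1 k) (s : k) :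
    f (ptOnL0 k s) = 0 := by
  have hle : CPL1 k ≤ LinearMap.ker (LinearMap.proj (R := ZMod 2) (ptOnL0 k s)) := by
    refine span_le.2 ?_
    rintro _ ⟨l, ⟨-, hl⟩, rfl⟩
    change chi k l (ptOnL0 k s) = 0
    rw [ptOnL0, chi_ptOf, if_neg]
    intro hmem
    have h : ![s, 1, 0, 0] ∈ l ⊓ l0 k := ⟨hmem, (mem_l0 k _).2 (by simp)⟩
    rw [hl, mem_bot] at h
    exact one_ne_zero (α := k) (by simpa using congrFun h 1)
  exact hle hf

lemma piP1_chi_lineThroughP0 (t : k) : piP1 k (chi k (lineThroughP0 k t)) = 0 := by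
  ext ⟨p, v, hv, hB⟩
  change chi k (lineThroughP0 k t) p = 0
  rw [chi, if_neg]
  intro hle
  apply hB
  simp [B, e, ((mem_lineThroughP0 k t v).1 (hle hv)).2]

lemma chi_lineThroughP0_ptOnL0 (s t : k) :
    chi k (lineThroughP0 k t) (ptOnL0 k s) = 0 := by
  simp [ptOnL0, chi_ptOf, mem_lineThroughP0]

lemma chi_lineThroughP0_ptOnPerp (t t' : k) :
    chi k (lineThroughP0 k t) (ptOnPerp k t') = if t' = t then 1 else 0 := by
  simp [ptOnPerp, chi_ptOf, mem_lineThroughP0]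

lemma chi_lineMeetingL0_ptOnL0 (s s' : k) :
    chi k (lineMeetingL0 k s) (ptOnL0 k s') = if s' = s then 1 else 0 := by
  simp [ptOnL0, chi_ptOf, mem_lineMeetingL0]

lemma chi_mem_CPL {l : Submodule k (Fin 4 → k)} (hl : IsLn k l) : chi k l ∈ CPL k :=
  subset_span ⟨l, hl, rfl⟩

lemma CPL1_le_CPL : CPL1 k ≤ CPL k :=
  span_mono (Set.image_mono fun _ hl => hl.1)

lemma finrank_CP1L1_add_le :
    finrank (ZMod 2) (CP1L1 k) + 2 * Fintype.card k ≤ finrank (ZMod 2) (CPL k) := by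
  obtain ⟨σ, hσ⟩ : ∃ σ : CP1L1 k →ₗ[ZMod 2] CPL1 k,
      (piP1 k).submoduleMap (CPL1 k) ∘ₗ σ = LinearMap.id :=
    LinearMap.exists_rightInverse_of_surjective ((piP1 k).submoduleMap (CPL1 k))
    (LinearMap.range_eq_top.2 ((piP1 k).submoduleMap_surjective (CPL1 k)))
  let n : k → CPL k := fun s => ⟨chi k (lineMeetingL0 k s), chi_mem_CPL k (isLn_lineMeetingL0 k s)⟩
  let m : k → CPL k := fun t => ⟨chi k (lineThroughP0 k t), chi_mem_CPL k (isLn_lineThroughP0 k t)⟩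
  let g : ((k → ZMod 2) × (k → ZMod 2)) × CP1L1 k →ₗ[ZMod 2] CPL k :=
    ((Fintype.linearCombination (ZMod 2) n).coprod (Fintype.linearCombination (ZMod 2) m)).coprod
      ((Submodule.inclusion (CPL1_le_CPL k)).comp σ)
  have hg_coe (a b : k → ZMod 2) (c : CP1L1 k) : (g ((a, b), c) : Pt k → ZMod 2) =
      ∑ s, a s • chi k (lineMeetingL0 k s) + ∑ t, b t • chi k (lineThroughP0 k t) + σ c := by
    simp [g, n, m, Fintype.linearCombination_apply, Submodule.coe_inclusion]
  have hg : Function.Injective g := by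
    rw [injective_iff_map_eq_zero]
    rintro ⟨⟨a, b⟩, c⟩ h
    have h' := hg_coe a b c
    rw [h, ZeroMemClass.coe_zero] at h'
    have ha : a = 0 := by
      ext s
      have := congrFun h' (ptOnL0 k s)
      simpa [chi_lineMeetingL0_ptOnL0, chi_lineThroughP0_ptOnL0,
        CPL1_apply_ptOnL0 k (σ c).2] using this.symm
    have hc : c = 0 := by
      have hπ := congrArg (piP1 k) h'
      have hσc : piP1 k (σ c) = c := congrArg Subtype.val (LinearMap.congr_fun hσ c)
      ext1
      simpa [ha, piP1_chi_lineThroughP0, hσc] using hπ.symm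
    have hb : b = 0 := by
      ext t
      have := congrFun h' (ptOnPerp k t)
      simpa [ha, hc, chi_lineThroughP0_ptOnPerp] using this.symm
    simp [ha, hb, hc]
  have h := LinearMap.finrank_le_finrank_of_injective hg
  simp only [finrank_prod, finrank_fintype_fun_eq_card] at h
  omega

lemma H3_col (c : k × k × k) :
    (H3 k).col c = LinearMap.funLeft (ZMod 2) (ZMod 2) (ptOfRow k)
      (piP1 k (chi k (lineOffL0 k c))) := by
  ext r
  change (if _ then _ else _) = chi k (lineOffL0 k c) (ptOfRow k r)
  rw [ptOfRow, chi_ptOf]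
  refine if_congr ?_ rfl rfl
  simp only [mem_lineOffL0, Matrix.cons_val]
  constructor
  · rintro ⟨h1, h2⟩
    constructor
    · linear_combination -h2
    · linear_combination -h1
  · rintro ⟨h1, h2⟩
    constructor
    · linear_combination -h2
    · linear_combination -h1

lemma finrank_range_H3_le :
    finrank (ZMod 2) (LinearMap.range (H3 k).mulVecLin) ≤ finrank (ZMod 2) (CP1L1 k) := by
  have hle : LinearMap.range (H3 k).mulVecLin ≤
      (CP1L1 k).map (LinearMap.funLeft (ZMod 2) (ZMod 2) (ptOfRow k)) := by
    rw [Matrix.range_mulVecLin, span_le]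
    rintro _ ⟨c, rfl⟩
    rw [H3_col]
    exact mem_map_of_mem (mem_map_of_mem (subset_span ⟨_, lineOffL0_mem_L1 k c, rfl⟩))
  exact (finrank_mono hle).trans (finrank_map_le _ _)

theorem dim_lower_bound (q : ℕ) (hq : Fintype.card k = q) :
    finrank (ZMod 2) (CP1L1 k) + 2 * q ≤ finrank (ZMod 2) (CPL k) ∧
    (q : ℤ) ^ 3 - finrank (ZMod 2) (CPL k) + 2 * q ≤ finrank (ZMod 2) (LUcode k) := by
  subst hq
  have h := finrank_CP1L1_add_le k
  refine ⟨h, ?_⟩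
  have hr := finrank_range_H3_le k
  have hn := LinearMap.finrank_range_add_finrank_ker (H3 k).mulVecLin
  rw [finrank_fintype_fun_eq_card, Fintype.card_prod, Fintype.card_prod] at hn
  change _ + finrank (ZMod 2) (LUcode k) = _ at hn
  have hq3 : (Fintype.card k : ℤ) ^ 3 = finrank (ZMod 2) (LinearMap.range (H3 k).mulVecLin)
      + finrank (ZMod 2) (LUcode k) := by
    rw [← Nat.cast_add, hn]
    push_cast
    ring
  omega
end
end

section
/- Let q = 2^t for a positive integer t. Let p be a point on the line ℓ0, and let ℓ and ℓ' be two lines of L \ {ℓ0} both containing p. Then χ_ℓ + χ_{ℓ'} lies in C(P,L1). -/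
open Submodule Module
open scoped Classical

noncomputable section

variable (k : Type) [Field k] [Fintype k]

section GridLemma

variable {F : Type} [Field F]

theorem B_add_left (u v w : Fin 4 → F) : B F (u + v) w = B F u w + B F v w := by
  simp only [B, Pi.add_apply]; ring

theorem B_add_right (u v w : Fin 4 → F) : B F u (v + w) = B F u v + B F u w := by
  simp only [B, Pi.add_apply]; ring

theorem B_smul_left (c : F) (u v : Fin 4 → F) : B F (c • u) v = c * B F u v := by
  simp only [B, Pi.smul_apply, smul_eq_mul]; ring

theorem B_smul_right (c : F) (u v : Fin 4 → F) : B F u (c • v) = c * B F u v := by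
  simp only [B, Pi.smul_apply, smul_eq_mul]; ring

theorem B_self (u : Fin 4 → F) : B F u u = 0 := by
  simp only [B]; ring

theorem B_swap (u v : Fin 4 → F) : B F u v = -B F v u := by
  simp only [B]; ring

theorem eq_zero_of_B_eq_zero {u : Fin 4 → F} (h : ∀ v, B F u v = 0) : u = 0 := by
  have h0 := h (Pi.single 0 1)
  have h1 := h (Pi.single 1 1)
  have h2 := h (Pi.single 2 1)
  have h3 := h (Pi.single 3 1)
  simp [B] at h0 h1 h2 h3
  funext i
  fin_cases i <;> simpa

theorem exists_B_eq_one {v : Fin 4 → F} (hv : v ≠ 0) : ∃ w, B F v w = 1 := by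
  by_contra! h
  refine hv (eq_zero_of_B_eq_zero fun w => ?_)
  by_contra hw
  exact h ((B F v w)⁻¹ • w) (by rw [B_smul_right, inv_mul_cancel₀ hw])

theorem eq_span_pair {l : Submodule F (Fin 4 → F)} (hl : finrank F l = 2) {v a : Fin 4 → F}
    (hv : v ∈ l) (ha : a ∈ l) (hv0 : v ≠ 0) (hav : ∀ c : F, c • v ≠ a) : l = span F {v, a} := by
  have hli : LinearIndependent F ![v, a] := (LinearIndependent.pair_iff' hv0).2 hav
  have hfr := finrank_span_eq_card hli
  rw [Matrix.range_cons_cons_empty] at hfr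
  refine (eq_of_le_of_finrank_eq (span_le.2 ?_) ?_).symm
  · rintro x (rfl | rfl) <;> assumption
  · rw [hfr, hl, Fintype.card_fin]

theorem exists_eq_span_pair {l : Submodule F (Fin 4 → F)} (hl : finrank F l = 2) {v : Fin 4 → F}
    (hv : v ∈ l) (hv0 : v ≠ 0) : ∃ a ∈ l, (∀ c : F, c • v ≠ a) ∧ l = span F {v, a} := by
  have : ∃ a ∈ l, ∀ c : F, c • v ≠ a := by
    by_contra! h
    have hle : l ≤ span F {v} := fun a ha => mem_span_singleton.2 (h a ha)
    have := finrank_mono hle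
    rw [hl, finrank_span_singleton hv0] at this
    omega
  obtain ⟨a, ha, hav⟩ := this
  exact ⟨a, ha, hav, eq_span_pair hl hv ha hv0 hav⟩

theorem exists_smul_eq_of_mem_of_mem {l m : Submodule F (Fin 4 → F)} (hl : finrank F l = 2)
    (hm : finrank F m = 2) (hlm : l ≠ m) {v u : Fin 4 → F} (hv0 : v ≠ 0) (hvl : v ∈ l)
    (hvm : v ∈ m) (hul : u ∈ l) (hum : u ∈ m) : ∃ c : F, c • v = u := by
  by_contra! h
  exact hlm ((eq_span_pair hl hvl hul hv0 h).trans (eq_span_pair hm hvm hum hv0 h).symm)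

/-- Three independent vectors in the hyperplane `v^⊥`, together with a vector outside it,
span `F^4`. -/
theorem exists_coords {v a b w : Fin 4 → F}
    (hli : ∀ x y z : F, x • v + y • a + z • b = 0 → x = 0 ∧ y = 0 ∧ z = 0)
    (hva : B F v a = 0) (hvb : B F v b = 0) (hvw : B F v w = 1) (u : Fin 4 → F) :
    ∃ x y z r : F, u = x • v + y • a + z • b + r • w := by
  have hli' : LinearIndependent F ![v, a, b, w] := by
    rw [Fintype.linearIndependent_iff]
    intro g hg
    simp [Fin.sum_univ_four] at hg
    have h3 : g 3 = 0 := by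
      have := congrArg (B F v) hg
      simp only [B_add_right, B_smul_right, B_self, hva, hvb, hvw] at this
      simpa [B] using this
    rw [h3, zero_smul, add_zero] at hg
    obtain ⟨h0, h1, h2⟩ := hli _ _ _ hg
    intro i
    fin_cases i <;> assumption
  have htop := hli'.span_eq_top_of_card_eq_finrank (by simp)
  have hu : u ∈ span F (Set.range ![v, a, b, w]) := htop ▸ mem_top
  obtain ⟨c, hc⟩ := (mem_span_range_iff_exists_fun F).1 hu
  refine ⟨c 0, c 1, c 2, c 3, ?_⟩
  rw [← hc]
  simp [Fin.sum_univ_four]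

/-- A totally isotropic subspace of `F^4` has no three independent vectors. -/
theorem B_ne_zero_of_independent {v a b : Fin 4 → F} (hv0 : v ≠ 0)
    (hli : ∀ x y z : F, x • v + y • a + z • b = 0 → x = 0 ∧ y = 0 ∧ z = 0)
    (hva : B F v a = 0) (hvb : B F v b = 0) : B F a b ≠ 0 := by
  intro hab
  obtain ⟨w, hw⟩ := exists_B_eq_one hv0
  have h : (-B F a w) • v + (1 : F) • a = 0 := by
    refine eq_zero_of_B_eq_zero fun u => ?_
    obtain ⟨x, y, z, r, rfl⟩ := exists_coords hli hva hvb hw u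
    simp only [B_add_left, B_add_right, B_smul_left, B_smul_right, B_self, hva, hvb, hab, hw,
      B_swap a v]
    ring
  exact one_ne_zero (hli (-B F a w) 1 0 (by rw [h]; simp)).2.1

/-- A nonzero `2 × 2` matrix is singular iff its second row vanishes or its first row is a
(necessarily unique) multiple of the second. -/
theorem sum_ite_proportional [Fintype F] (x y z r : F) (h : ¬(x = 0 ∧ y = 0 ∧ z = 0 ∧ r = 0)) :
    ((if z = 0 ∧ r = 0 then 1 else 0) + ∑ s : F, if x = s * z ∧ y = s * r then 1 else 0 : ZMod 2)
      = if x * r = y * z then 1 else 0 := by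
  by_cases hzr : z = 0 ∧ r = 0
  · obtain ⟨rfl, rfl⟩ := hzr
    have : ¬(x = 0 ∧ y = 0) := fun hxy => h ⟨hxy.1, hxy.2, rfl, rfl⟩
    simp [this]
  rw [if_neg hzr, zero_add]
  by_cases hd : x * r = y * z
  · rw [if_pos hd]
    have hu : ∃ s₀ : F, ∀ s : F, (x = s * z ∧ y = s * r) ↔ s = s₀ := by
      by_cases hz : z = 0
      · have hr : r ≠ 0 := fun hr => hzr ⟨hz, hr⟩
        subst hz
        have hx : x = 0 := by simpa [hr] using hd
        refine ⟨y / r, fun s => ?_⟩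
        rw [eq_div_iff hr]
        simp [hx, eq_comm]
      · refine ⟨x / z, fun s => ⟨fun hs => ?_, fun hs => ?_⟩⟩
        · rw [eq_div_iff hz, hs.1]
        · subst hs
          refine ⟨by field_simp, ?_⟩
          field_simp
          linear_combination -hd
    obtain ⟨s₀, hs₀⟩ := hu
    simp [hs₀]
  · rw [if_neg hd]
    refine Finset.sum_eq_zero fun s _ => if_neg ?_
    rintro ⟨rfl, rfl⟩
    exact hd (by ring)

theorem chi_apply_of_eq_span {P : Pt F} {u : Fin 4 → F}
    (hu : (P : Submodule F (Fin 4 → F)) = span F {u}) (l : Submodule F (Fin 4 → F)) :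
    chi F l P = if u ∈ l then 1 else 0 := by
  simp only [chi, hu, span_singleton_le_iff_mem]

/-- `v, a, b, w` is a symplectic basis of `F^4`, with hyperbolic pairs `(v, w)` and `(a, b)`. -/
structure IsSymplecticFrame (v a b w : Fin 4 → F) : Prop where
  va : B F v a = 0
  vb : B F v b = 0
  wa : B F w a = 0
  wb : B F w b = 0
  ab : B F a b = 1
  vw : B F v w = 1
  exists_coords : ∀ u, ∃ x y z r : F, u = x • v + y • a + z • b + r • w

namespace IsSymplecticFrame

variable {v a b w : Fin 4 → F}

theorem B_left (h : IsSymplecticFrame v a b w) (x y z r : F) :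
    B F (x • v + y • a + z • b + r • w) w = x ∧ B F (x • v + y • a + z • b + r • w) b = y ∧
    B F a (x • v + y • a + z • b + r • w) = z ∧ B F v (x • v + y • a + z • b + r • w) = r := by
  simp [B_add_left, B_add_right, B_smul_left, B_smul_right, B_self, h.va, h.vb, h.wa, h.wb,
    h.ab, h.vw, B_swap a v, B_swap b w, B_swap a w]

theorem coords_inj (h : IsSymplecticFrame v a b w) {x y z r x' y' z' r' : F} :
    x • v + y • a + z • b + r • w = x' • v + y' • a + z' • b + r' • w ↔
      x = x' ∧ y = y' ∧ z = z' ∧ r = r' := by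
  constructor
  · intro he
    obtain ⟨h0, h1, h2, h3⟩ := h.B_left x y z r
    obtain ⟨h0', h1', h2', h3'⟩ := h.B_left x' y' z' r'
    rw [he] at h0 h1 h2 h3
    exact ⟨h0.symm.trans h0', h1.symm.trans h1', h2.symm.trans h2', h3.symm.trans h3'⟩
  · rintro ⟨rfl, rfl, rfl, rfl⟩
    rfl

theorem swap [CharP F 2] (h : IsSymplecticFrame v a b w) : IsSymplecticFrame v b a w where
  va := h.vb
  vb := h.va
  wa := h.wb
  wb := h.wa
  ab := by rw [B_swap, h.ab, CharTwo.neg_eq]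
  vw := h.vw
  exists_coords u := by
    obtain ⟨x, y, z, r, rfl⟩ := h.exists_coords u
    exact ⟨x, z, y, r, by abel⟩

theorem mem_span_va (h : IsSymplecticFrame v a b w) {x y z r : F} :
    x • v + y • a + z • b + r • w ∈ span F {v, a} ↔ z = 0 ∧ r = 0 := by
  rw [mem_span_pair]
  constructor
  · rintro ⟨c, d, hcd⟩
    have : c • v + d • a + (0 : F) • b + (0 : F) • w = x • v + y • a + z • b + r • w := by
      rw [← hcd]; simp
    obtain ⟨-, -, h2, h3⟩ := h.coords_inj.1 this
    exact ⟨h2.symm, h3.symm⟩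
  · rintro ⟨rfl, rfl⟩
    exact ⟨x, y, by simp⟩

/-- The lines of the regulus through `span {v, a}`, other than `span {v, a}` itself. -/
theorem mem_span_regulus (h : IsSymplecticFrame v a b w) {s x y z r : F} :
    x • v + y • a + z • b + r • w ∈ span F {s • v + b, s • a + w} ↔ x = s * z ∧ y = s * r := by
  rw [mem_span_pair]
  constructor
  · rintro ⟨c, d, hcd⟩
    have : (c * s) • v + (d * s) • a + c • b + d • w = x • v + y • a + z • b + r • w := by
      rw [← hcd]; module
    obtain ⟨rfl, rfl, rfl, rfl⟩ := h.coords_inj.1 this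
    exact ⟨mul_comm _ _, mul_comm _ _⟩
  · rintro ⟨rfl, rfl⟩
    exact ⟨z, r, by module⟩

theorem isLn_regulus (h : IsSymplecticFrame v a b w) (s : F) :
    IsLn F (span F {s • v + b, s • a + w}) := by
  constructor
  · have hli : LinearIndependent F ![s • v + b, s • a + w] := by
      rw [LinearIndependent.pair_iff]
      intro c d hcd
      have : (c * s) • v + (d * s) • a + c • b + d • w =
          (0 : F) • v + (0 : F) • a + (0 : F) • b + (0 : F) • w := by
        simp only [zero_smul, add_zero]
        rw [← hcd]; module
      obtain ⟨-, -, h2, h3⟩ := h.coords_inj.1 this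
      exact ⟨h2, h3⟩
    have hfr := finrank_span_eq_card hli
    rwa [Matrix.range_cons_cons_empty, Fintype.card_fin] at hfr
  · intro u hu u' hu'
    obtain ⟨c, d, rfl⟩ := mem_span_pair.1 hu
    obtain ⟨c', d', rfl⟩ := mem_span_pair.1 hu'
    simp only [B_add_left, B_add_right, B_smul_left, B_smul_right, B_self, h.va, h.vb, h.wa, h.wb,
      h.ab, h.vw, B_swap a v, B_swap b w, B_swap a w, B_swap b v, B_swap w v, B_swap b a]
    ring

/-- If `m` is a line through `v` distinct from `span {v, b}`, then the lines of the regulus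
through `span {v, a}`, other than `span {v, a}` itself, are disjoint from `m`. -/
theorem regulus_inf_eq_bot (h : IsSymplecticFrame v a b w) {m : Submodule F (Fin 4 → F)}
    (hm : IsLn F m) (hvm : v ∈ m) (hmb : ∀ u ∈ span F {v, b}, u ∈ m → ∃ c : F, c • v = u) (s : F) :
    span F {s • v + b, s • a + w} ⊓ m = ⊥ := by
  rw [eq_bot_iff]
  rintro u ⟨hu, hum⟩
  obtain ⟨x, y, z, r, rfl⟩ := h.exists_coords u
  obtain ⟨rfl, rfl⟩ := h.mem_span_regulus.1 hu
  have hr : r = 0 := (h.B_left _ _ _ _).2.2.2.symm.trans (hm.2 _ hvm _ hum)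
  subst hr
  obtain ⟨c, hc⟩ := hmb _ (mem_span_pair.2 ⟨s * z, z, by simp⟩) hum
  have : c • v + (0 : F) • a + (0 : F) • b + (0 : F) • w =
      (s * z) • v + (s * 0) • a + z • b + (0 : F) • w := by
    rw [← hc]; simp
  obtain ⟨-, -, h2, -⟩ := h.coords_inj.1 this
  simp [← h2]

theorem chi_add_sum_regulus [Fintype F] (h : IsSymplecticFrame v a b w) {P : Pt F} {x y z r : F}
    (hu0 : x • v + y • a + z • b + r • w ≠ 0)
    (hP : (P : Submodule F (Fin 4 → F)) = span F {x • v + y • a + z • b + r • w}) :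
    chi F (span F {v, a}) P + ∑ s : F, chi F (span F {s • v + b, s • a + w}) P =
      if x * r = y * z then 1 else 0 := by
  simp only [chi_apply_of_eq_span hP, h.mem_span_va, h.mem_span_regulus]
  refine sum_ite_proportional x y z r ?_
  rintro ⟨rfl, rfl, rfl, rfl⟩
  simp at hu0

/-- The sum of the characteristic functions of all the lines of a grid is zero. -/
theorem chi_add_chi_eq [Fintype F] [CharP F 2] (h : IsSymplecticFrame v a b w) :
    chi F (span F {v, a}) + chi F (span F {v, b}) =
      ∑ s : F, chi F (span F {s • v + b, s • a + w}) +
        ∑ s : F, chi F (span F {s • v + a, s • b + w}) := by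
  funext P
  simp only [Pi.add_apply, Finset.sum_apply]
  obtain ⟨u, hu0, hu⟩ : ∃ u : Fin 4 → F, u ≠ 0 ∧ (P : Submodule F (Fin 4 → F)) = span F {u} := by
    obtain ⟨u, hu0, hu⟩ := finrank_eq_one_iff'.1 P.2
    refine ⟨u, by simpa using hu0, le_antisymm (fun x hx => ?_) ?_⟩
    · obtain ⟨c, hc⟩ := hu ⟨x, hx⟩
      exact mem_span_singleton.2 ⟨c, congrArg Subtype.val hc⟩
    · simp
  obtain ⟨x, y, z, r, rfl⟩ := h.exists_coords u
  have h1 := h.chi_add_sum_regulus hu0 hu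
  rw [add_right_comm (x • v)] at hu0 hu
  have h2 := h.swap.chi_add_sum_regulus hu0 hu
  rw [mul_comm z y, ← h1] at h2
  clear h1
  generalize chi F (span F {v, a}) P = A at *
  generalize chi F (span F {v, b}) P = A' at *
  generalize (∑ s : F, chi F (span F {s • v + b, s • a + w}) P) = S at *
  generalize (∑ s : F, chi F (span F {s • v + a, s • b + w}) P) = S' at *
  revert A A' S S'
  decide

end IsSymplecticFrame

theorem exists_isSymplecticFrame {v a b : Fin 4 → F} (hv0 : v ≠ 0)
    (hli : ∀ x y z : F, x • v + y • a + z • b = 0 → x = 0 ∧ y = 0 ∧ z = 0)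
    (hva : B F v a = 0) (hvb : B F v b = 0) (hab : B F a b = 1) :
    ∃ w, IsSymplecticFrame v a b w := by
  obtain ⟨w, hw⟩ := exists_B_eq_one hv0
  have hvw : B F v (w + (-B F w b) • a + B F w a • b) = 1 := by
    simp only [B_add_right, B_smul_right, hva, hvb, hw]
    ring
  refine ⟨w + (-B F w b) • a + B F w a • b, hva, hvb, ?_, ?_, hab, hvw,
    exists_coords hli hva hvb hvw⟩
  · simp only [B_add_left, B_smul_left, B_self, B_swap b a, hab]
    ring
  · simp only [B_add_left, B_smul_left, B_self, hab]
    ring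

theorem finrank_l0 : finrank F (l0 F) = 2 := by
  have hli : LinearIndependent F ![e F 0, e F 1] := by
    rw [LinearIndependent.pair_iff]
    intro c d hcd
    have h0 := congrFun hcd 0
    have h1 := congrFun hcd 1
    simp [e] at h0 h1
    exact ⟨h0, h1⟩
  have hfr := finrank_span_eq_card hli
  rwa [Matrix.range_cons_cons_empty, Fintype.card_fin] at hfr

theorem isLn_l0 : IsLn F (l0 F) := by
  refine ⟨finrank_l0, fun u hu u' hu' => ?_⟩
  obtain ⟨c, d, rfl⟩ := mem_span_pair.1 hu
  obtain ⟨c', d', rfl⟩ := mem_span_pair.1 hu'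
  simp [B, e]

end GridLemma

theorem grid_lemma (t : ℕ) (ht : 0 < t) (q : ℕ) (hq : q = 2 ^ t)
    (hcard : Fintype.card k = q)
    (p : Pt k) (hp : (p : Submodule k (Fin 4 → k)) ≤ l0 k)
    (l l' : Submodule k (Fin 4 → k)) (hl : IsLn k l) (hl' : IsLn k l')
    (hlne : l ≠ l0 k) (hl'ne : l' ≠ l0 k)
    (hpl : (p : Submodule k (Fin 4 → k)) ≤ l)
    (hpl' : (p : Submodule k (Fin 4 → k)) ≤ l') :
    chi k l + chi k l' ∈ CPL1 k := by
  have h2 : (2 : k) = 0 := by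
    have h : ((Fintype.card k : ℕ) : k) = 0 := Nat.cast_card_eq_zero k
    rw [hcard, hq] at h
    push_cast at h
    exact eq_zero_of_pow_eq_zero h
  have : CharP k 2 := CharTwo.of_one_ne_zero_of_two_eq_zero one_ne_zero h2
  by_cases hll : l = l'
  · rw [← hll, show chi k l + chi k l = 0 from funext fun _ => CharTwo.add_self_eq_zero _]
    exact zero_mem _
  obtain ⟨v, hv0, -⟩ := finrank_eq_one_iff'.1 p.2
  obtain ⟨v, hvp⟩ := v
  replace hv0 : v ≠ 0 := by simpa using hv0
  obtain ⟨a, hal, hav, hla⟩ := exists_eq_span_pair hl.1 (hpl hvp) hv0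
  obtain ⟨b, hbl', hbv, hlb⟩ := exists_eq_span_pair hl'.1 (hpl' hvp) hv0
  have hva := hl.2 v (hpl hvp) a hal
  have hvb := hl'.2 v (hpl' hvp) b hbl'
  have hli : ∀ x y z : k, x • v + y • a + z • b = 0 → x = 0 ∧ y = 0 ∧ z = 0 := by
    intro x y z h
    have hz : z = 0 := by
      by_contra hz
      have hb : b = (-z⁻¹ * x) • v + (-z⁻¹ * y) • a := by
        have : z⁻¹ • (x • v + y • a + z • b) = 0 := by rw [h, smul_zero]
        rw [smul_add, inv_smul_smul₀ hz, add_comm] at this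
        rw [eq_neg_of_add_eq_zero_left this]
        module
      have hbl : b ∈ l := by
        rw [hla, mem_span_pair]
        exact ⟨_, _, hb.symm⟩
      obtain ⟨c, hc⟩ := exists_smul_eq_of_mem_of_mem hl.1 hl'.1 hll hv0 (hpl hvp) (hpl' hvp)
        hbl hbl'
      exact hbv c hc
    subst hz
    rw [zero_smul, add_zero] at h
    obtain ⟨hx, hy⟩ := LinearIndependent.pair_iff.1 ((LinearIndependent.pair_iff' hv0).2 hav) x y h
    exact ⟨hx, hy, rfl⟩
  have hab := B_ne_zero_of_independent hv0 hli hva hvb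
  have hli' : ∀ x y z : k, x • v + y • a + z • ((B k a b)⁻¹ • b) = 0 →
      x = 0 ∧ y = 0 ∧ z = 0 := by
    intro x y z h
    rw [smul_smul] at h
    obtain ⟨hx, hy, hz⟩ := hli _ _ _ h
    exact ⟨hx, hy, by simpa [hab] using hz⟩
  have hlb' : l' = span k {v, (B k a b)⁻¹ • b} := by
    refine eq_span_pair hl'.1 (hpl' hvp) (smul_mem _ _ hbl') hv0 fun c hc => ?_
    refine hbv (B k a b * c) ?_
    rw [mul_smul, hc, smul_inv_smul₀ hab]
  obtain ⟨w, hw⟩ := exists_isSymplecticFrame hv0 hli' hva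
    (by rw [B_smul_right, hvb, mul_zero]) (by rw [B_smul_right, inv_mul_cancel₀ hab])
  have hmeet : ∀ m : Submodule k (Fin 4 → k), IsLn k m → m ≠ l0 k → v ∈ m →
      ∀ u ∈ m, u ∈ l0 k → ∃ c : k, c • v = u := fun m hm hne hvm u hum hu =>
    exists_smul_eq_of_mem_of_mem hm.1 finrank_l0 hne hv0 hvm (hp hvp) hum hu
  have hmem : ∀ m ∈ L1 k, chi k m ∈ CPL1 k := fun m hm => subset_span ⟨m, hm, rfl⟩
  rw [hla, hlb', hw.chi_add_chi_eq]
  refine add_mem (sum_mem fun s _ => hmem _ ⟨hw.isLn_regulus s, ?_⟩)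
    (sum_mem fun s _ => hmem _ ⟨hw.swap.isLn_regulus s, ?_⟩)
  · exact hw.regulus_inf_eq_bot isLn_l0 (hp hvp) (hlb' ▸ hmeet l' hl' hl'ne (hpl' hvp)) s
  · exact hw.swap.regulus_inf_eq_bot isLn_l0 (hp hvp) (hla ▸ hmeet l hl hlne (hpl hvp)) s
end
end

section
/- Let q = 2^t for a positive integer t. For any choice of the set Y, the characteristic function χ_{ℓ0} lies in the F_2-span of X0 ∪ Y ∪ {χ_m : m ∈ L1}. -/
open Submodule Module
open scoped Classical

noncomputable section

variable (k : Type) [Field k] [Fintype k]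

variable {k}

/-- The form `B` as a bundled bilinear form. -/
def symplecticForm : LinearMap.BilinForm k (Fin 4 → k) :=
  LinearMap.mk₂ k (B k)
    (by intros; simp only [B, Pi.add_apply]; ring)
    (by intros; simp only [B, Pi.smul_apply, smul_eq_mul]; ring)
    (by intros; simp only [B, Pi.add_apply]; ring)
    (by intros; simp only [B, Pi.smul_apply, smul_eq_mul]; ring)

omit [Fintype k] in
lemma eq_zero_of_forall_B_eq_zero {x : Fin 4 → k} (h : ∀ y, B k x y = 0) : x = 0 := by
  have h0 := h (Pi.single 0 1)
  have h1 := h (Pi.single 1 1)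
  have h2 := h (Pi.single 2 1)
  have h3 := h (Pi.single 3 1)
  simp [B] at h0 h1 h2 h3
  ext i
  fin_cases i <;> simp_all

omit [Fintype k] in
lemma symplecticForm_isRefl : (symplecticForm (k := k)).IsRefl := by
  intro x y h
  change B k x y = 0 at h
  change B k y x = 0
  simp only [B] at h ⊢
  linear_combination -h

omit [Fintype k] in
lemma symplecticForm_nondegenerate : (symplecticForm (k := k)).Nondegenerate :=
  ⟨fun _ h => eq_zero_of_forall_B_eq_zero h,
    fun y h => eq_zero_of_forall_B_eq_zero fun x => symplecticForm_isRefl x y (h x)⟩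

omit [Fintype k] in
lemma IsLn.mem_of_forall_B_eq_zero {l : Submodule k (Fin 4 → k)} (hl : IsLn k l)
    {x : Fin 4 → k} (hx : ∀ y ∈ l, B k y x = 0) : x ∈ l := by
  have hle : l ≤ symplecticForm.orthogonal l := fun u hu v hv => hl.2 v hv u hu
  have hdim := LinearMap.BilinForm.finrank_orthogonal symplecticForm_nondegenerate l
  have heq : l = symplecticForm.orthogonal l := by
    apply Submodule.eq_of_le_of_finrank_eq hle
    rw [hdim, hl.1]
    simp
  rw [heq]
  exact hx

omit [Fintype k] in
lemma IsLn.eq_of_le {l m : Submodule k (Fin 4 → k)} (hl : IsLn k l) (hm : IsLn k m)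
    (h : l ≤ m) : l = m :=
  Submodule.eq_of_le_of_finrank_eq h (hl.1.trans hm.1.symm)

omit [Fintype k] in
lemma isLn_span_pair_s6 {u v : Fin 4 → k} (h : LinearIndependent k ![u, v]) (huv : B k u v = 0) :
    IsLn k (span k {u, v}) := by
  refine ⟨?_, ?_⟩
  · have := finrank_span_eq_card h
    rwa [Matrix.range_cons_cons_empty, Fintype.card_fin] at this
  · intro x hx y hy
    obtain ⟨a, b, rfl⟩ := mem_span_pair.1 hx
    obtain ⟨c, d, rfl⟩ := mem_span_pair.1 hy
    simp only [B, Pi.add_apply, Pi.smul_apply, smul_eq_mul] at huv ⊢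
    linear_combination (a * d - b * c) * huv

omit [Fintype k] in
lemma IsLn.exists_eq_span_pair {l : Submodule k (Fin 4 → k)} (hl : IsLn k l)
    {w : Fin 4 → k} (hw : w ≠ 0) (hwl : w ∈ l) : ∃ a, l = span k {w, a} := by
  have hnot : ¬ l ≤ span k {w} := by
    intro h
    have := Submodule.finrank_mono h
    rw [hl.1, finrank_span_singleton hw] at this
    omega
  obtain ⟨a, hal, ha⟩ := SetLike.not_le_iff_exists.1 hnot
  have hind : LinearIndependent k ![w, a] := by
    rw [LinearIndependent.pair_iff' hw]
    intro c hc
    exact ha (mem_span_singleton.2 ⟨c, hc⟩)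
  refine ⟨a, ((isLn_span_pair_s6 hind (hl.2 w hwl a hal)).eq_of_le hl ?_).symm⟩
  rw [span_le]
  rintro x (rfl | rfl) <;> assumption

/-- The lines of one ruling of the quadric `x₀x₃ = x₁x₂`. -/
def ruling (s t : k) : Submodule k (Fin 4 → k) := span k {![s, 0, t, 0], ![0, s, 0, t]}

/-- The lines of the opposite ruling of the quadric `x₀x₃ = x₁x₂`. -/
def oppositeRuling (s t : k) : Submodule k (Fin 4 → k) := span k {![s, t, 0, 0], ![0, 0, s, t]}

omit [Fintype k] in
lemma mem_ruling_one_zero {x : Fin 4 → k} : x ∈ ruling 1 0 ↔ x 2 = 0 ∧ x 3 = 0 := by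
  rw [ruling, mem_span_pair]
  constructor
  · rintro ⟨a, b, rfl⟩
    simp
  · rintro ⟨h2, h3⟩
    refine ⟨x 0, x 1, ?_⟩
    ext i
    fin_cases i <;> simp [h2, h3]

omit [Fintype k] in
lemma mem_ruling_one {x : Fin 4 → k} {c : k} :
    x ∈ ruling c 1 ↔ x 0 = c * x 2 ∧ x 1 = c * x 3 := by
  rw [ruling, mem_span_pair]
  constructor
  · rintro ⟨a, b, rfl⟩
    simp [mul_comm]
  · rintro ⟨h2, h3⟩
    refine ⟨x 2, x 3, ?_⟩
    ext i
    fin_cases i <;> simp [h2, h3, mul_comm]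

omit [Fintype k] in
lemma mem_oppositeRuling_one_zero {x : Fin 4 → k} :
    x ∈ oppositeRuling 1 0 ↔ x 1 = 0 ∧ x 3 = 0 := by
  rw [oppositeRuling, mem_span_pair]
  constructor
  · rintro ⟨a, b, rfl⟩
    simp
  · rintro ⟨h2, h3⟩
    refine ⟨x 0, x 2, ?_⟩
    ext i
    fin_cases i <;> simp [h2, h3]

omit [Fintype k] in
lemma mem_oppositeRuling_one {x : Fin 4 → k} {c : k} :
    x ∈ oppositeRuling c 1 ↔ x 0 = c * x 1 ∧ x 2 = c * x 3 := by
  rw [oppositeRuling, mem_span_pair]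
  constructor
  · rintro ⟨a, b, rfl⟩
    simp [mul_comm]
  · rintro ⟨h2, h3⟩
    refine ⟨x 1, x 3, ?_⟩
    ext i
    fin_cases i <;> simp [h2, h3, mul_comm]

omit [Fintype k] in
lemma isLn_ruling {s t : k} (h : s ≠ 0 ∨ t ≠ 0) : IsLn k (ruling s t) := by
  refine isLn_span_pair_s6 (LinearIndependent.pair_iff.2 fun a b hab => ?_) (by simp [B]; ring)
  have h0 := congrFun hab 0
  have h1 := congrFun hab 1
  have h2 := congrFun hab 2
  have h3 := congrFun hab 3
  simp at h0 h1 h2 h3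
  grind

omit [Fintype k] in
lemma isLn_oppositeRuling (hk : (2 : k) = 0) {s t : k} (h : s ≠ 0 ∨ t ≠ 0) :
    IsLn k (oppositeRuling s t) := by
  refine isLn_span_pair_s6 (LinearIndependent.pair_iff.2 fun a b hab => ?_)
    (by simp [B]; linear_combination s * t * hk)
  have h0 := congrFun hab 0
  have h1 := congrFun hab 1
  have h2 := congrFun hab 2
  have h3 := congrFun hab 3
  simp at h0 h1 h2 h3
  grind

omit [Fintype k] in
lemma IsLn.map {l : Submodule k (Fin 4 → k)} (hl : IsLn k l)
    {g : (Fin 4 → k) ≃ₗ[k] (Fin 4 → k)} (hg : ∀ x y, B k (g x) (g y) = B k x y) :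
    IsLn k (l.map (g : (Fin 4 → k) →ₗ[k] (Fin 4 → k))) := by
  refine ⟨(LinearEquiv.finrank_map_eq g l).trans hl.1, ?_⟩
  rintro _ ⟨x, hx, rfl⟩ _ ⟨y, hy, rfl⟩
  exact (hg x y).trans (hl.2 x hx y hy)

/-- Both rulings of a hyperbolic quadric cover the same points, each point once. -/
lemma sum_chi_ruling (g : (Fin 4 → k) ≃ₗ[k] (Fin 4 → k)) :
    chi k ((ruling 1 0).map (g : (Fin 4 → k) →ₗ[k] (Fin 4 → k))) +
        ∑ c : k, chi k ((ruling c 1).map (g : (Fin 4 → k) →ₗ[k] (Fin 4 → k))) =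
      chi k ((oppositeRuling 1 0).map (g : (Fin 4 → k) →ₗ[k] (Fin 4 → k))) +
        ∑ c : k, chi k ((oppositeRuling c 1).map (g : (Fin 4 → k) →ₗ[k] (Fin 4 → k))) := by
  ext ⟨p, hp⟩
  obtain ⟨v, hv, hspan⟩ := finrank_eq_one_iff'.1 hp
  obtain ⟨y, hy⟩ := g.surjective (v : Fin 4 → k)
  have hy0 : y ≠ 0 := by
    rintro rfl
    exact hv (Subtype.ext (by simpa using hy.symm))
  have hmem (l : Submodule k (Fin 4 → k)) :
      p ≤ l.map (g : (Fin 4 → k) →ₗ[k] (Fin 4 → k)) ↔ y ∈ l := by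
    constructor
    · intro h
      obtain ⟨z, hz, hzv⟩ := h v.2
      have : z = y := g.injective (hzv.trans hy.symm)
      exact this ▸ hz
    · intro h x hx
      obtain ⟨c, hc⟩ := hspan ⟨x, hx⟩
      have hc' : c • (v : Fin 4 → k) = x := congrArg Subtype.val hc
      exact ⟨c • y, l.smul_mem c h, by simp [hy, hc']⟩
  simp only [Pi.add_apply, Finset.sum_apply, chi, hmem, mem_ruling_one_zero, mem_ruling_one,
    mem_oppositeRuling_one_zero, mem_oppositeRuling_one]
  by_cases h3 : y 3 = 0
  · have h012 : y 0 ≠ 0 ∨ y 1 ≠ 0 ∨ y 2 ≠ 0 := by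
      by_contra! h
      apply hy0
      ext i
      fin_cases i <;> simp [h, h3]
    have key (a b : k) (hab : y 0 ≠ 0 ∨ a ≠ 0 ∨ b ≠ 0) :
        ((if b = 0 then 1 else 0) + ∑ c : k, if y 0 = c * b ∧ a = 0 then 1 else 0 : ZMod 2) =
          if a = 0 ∨ b = 0 then 1 else 0 := by
      by_cases hb : b = 0
      · have : ¬ (y 0 = 0 ∧ a = 0) := by tauto
        simp [hb, this]
      · by_cases ha : a = 0
        · have (c : k) : y 0 = c * b ↔ c = y 0 / b := by
            rw [eq_div_iff hb, eq_comm]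
          simp [hb, ha, this]
        · simp [ha, hb]
    simp only [h3, mul_zero, and_true]
    rw [key _ _ h012, key (y 2) (y 1) (by tauto)]
    simp only [or_comm]
  · have h1 (c : k) : (y 0 = c * y 2 ∧ y 1 = c * y 3) ↔
        (c = y 1 / y 3 ∧ y 0 * y 3 = y 1 * y 2) := by
      rw [eq_div_iff h3]
      grind
    have h2 (c : k) : (y 0 = c * y 1 ∧ y 2 = c * y 3) ↔
        (c = y 2 / y 3 ∧ y 0 * y 3 = y 1 * y 2) := by
      rw [eq_div_iff h3]
      grind
    simp only [h1, h2, h3, and_false, if_false]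
    by_cases hq : y 0 * y 3 = y 1 * y 2 <;> simp [hq]

omit [Fintype k] in
lemma exists_isometry {w a b d : Fin 4 → k} (hwa : B k w a = 0) (hwb : B k w b = 0)
    (hwd : B k w d = 1) (hab : B k a b = 1) (had : B k a d = 0) (hbd : B k b d = 0) :
    ∃ g : (Fin 4 → k) ≃ₗ[k] (Fin 4 → k), (∀ x y, B k (g x) (g y) = B k x y) ∧
      ∀ x, g x = x 0 • w + x 1 • a + x 2 • b + x 3 • d := by
  let f : (Fin 4 → k) →ₗ[k] (Fin 4 → k) := Fintype.linearCombination k ![w, a, b, d]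
  have hf (x) : f x = x 0 • w + x 1 • a + x 2 • b + x 3 • d := by
    simp [f, Fintype.linearCombination_apply, Fin.sum_univ_four]
  have hB (x y) : B k (f x) (f y) = B k x y := by
    rw [hf, hf]
    simp only [B, Pi.add_apply, Pi.smul_apply, smul_eq_mul] at *
    linear_combination (x 0 * y 1 - x 1 * y 0) * hwa + (x 0 * y 2 - x 2 * y 0) * hwb +
      (x 0 * y 3 - x 3 * y 0) * hwd + (x 1 * y 2 - x 2 * y 1) * hab +
      (x 1 * y 3 - x 3 * y 1) * had + (x 2 * y 3 - x 3 * y 2) * hbd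
  have hinj : Function.Injective f := by
    rw [injective_iff_map_eq_zero]
    intro x hx
    refine eq_zero_of_forall_B_eq_zero fun y => ?_
    rw [← hB, hx]
    simp [B]
  exact ⟨LinearEquiv.ofInjectiveEndo f hinj, hB, hf⟩

omit [Fintype k] in
/-- Two distinct concurrent lines are opposite lines of a hyperbolic quadric. -/
lemma exists_isometry_map_ruling {m m' : Submodule k (Fin 4 → k)} (hm : IsLn k m)
    (hm' : IsLn k m') (hne : m ≠ m') {w : Fin 4 → k} (hw : w ≠ 0) (hwm : w ∈ m)
    (hwm' : w ∈ m') :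
    ∃ g : (Fin 4 → k) ≃ₗ[k] (Fin 4 → k), (∀ x y, B k (g x) (g y) = B k x y) ∧
      g ![1, 0, 0, 0] = w ∧
      (ruling 1 0).map (g : (Fin 4 → k) →ₗ[k] (Fin 4 → k)) = m ∧
      (oppositeRuling 1 0).map (g : (Fin 4 → k) →ₗ[k] (Fin 4 → k)) = m' := by
  obtain ⟨a, rfl⟩ := hm.exists_eq_span_pair hw hwm
  obtain ⟨b, rfl⟩ := hm'.exists_eq_span_pair hw hwm'
  have ha : a ∈ span k {w, a} := subset_span (by simp)
  have hb : b ∈ span k {w, b} := subset_span (by simp)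
  have hwa := hm.2 w hwm a ha
  have hwb := hm'.2 w hwm' b hb
  have hab : B k a b ≠ 0 := by
    intro hab
    refine hne (hm'.eq_of_le hm (span_le.2 ?_)).symm
    rintro x (rfl | rfl)
    · exact hwm
    · refine hm.mem_of_forall_B_eq_zero fun y hy => ?_
      obtain ⟨r, s, rfl⟩ := mem_span_pair.1 hy
      simp only [B, Pi.add_apply, Pi.smul_apply, smul_eq_mul] at hab hwb ⊢
      linear_combination r * hwb + s * hab
  obtain ⟨d, hd⟩ : ∃ d, B k w d ≠ 0 := by
    by_contra! h
    exact hw (eq_zero_of_forall_B_eq_zero h)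
  set b' := (B k a b)⁻¹ • b with hb'
  set d' := (B k w d)⁻¹ • d with hd'
  have hwb' : B k w b' = 0 := by
    have : B k w b' = (B k a b)⁻¹ * B k w b := (symplecticForm w).map_smul _ b
    rw [this, hwb, mul_zero]
  have hab' : B k a b' = 1 := by
    have : B k a b' = (B k a b)⁻¹ * B k a b := (symplecticForm a).map_smul _ b
    rw [this, inv_mul_cancel₀ hab]
  have hwd' : B k w d' = 1 := by
    have : B k w d' = (B k w d)⁻¹ * B k w d := (symplecticForm w).map_smul _ d
    rw [this, inv_mul_cancel₀ hd]
  have hspan : span k {w, b} = span k {w, b'} := by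
    rw [span_insert, span_insert, hb', span_singleton_smul_eq (inv_ne_zero hab).isUnit]
  obtain ⟨g, hgB, hg⟩ := exists_isometry (d := d' - B k a d' • b' + B k b' d' • a) hwa hwb'
    (by
      simp only [B, Pi.add_apply, Pi.sub_apply, Pi.smul_apply, smul_eq_mul] at *
      grind) hab'
    (by
      simp only [B, Pi.add_apply, Pi.sub_apply, Pi.smul_apply, smul_eq_mul] at *
      grind)
    (by
      simp only [B, Pi.add_apply, Pi.sub_apply, Pi.smul_apply, smul_eq_mul] at *
      grind)
  refine ⟨g, hgB, by simp [hg], ?_, ?_⟩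
  · rw [ruling, map_span, Set.image_pair]
    simp [hg]
  · rw [hspan, oppositeRuling, map_span, Set.image_pair]
    simp [hg]

/-- The sum of two concurrent lines `m`, `m'` is spanned by the lines disjoint from any third line
through their common point. -/
lemma chi_add_chi_mem_span (hk : (2 : k) = 0) {l m m' : Submodule k (Fin 4 → k)} (hl : IsLn k l)
    (hm : IsLn k m) (hm' : IsLn k m') (hml : m ≠ l) (hml' : m' ≠ l) {w : Fin 4 → k}
    (hw : w ≠ 0) (hwl : w ∈ l) (hwm : w ∈ m) (hwm' : w ∈ m') :
    chi k m + chi k m' ∈ span (ZMod 2) (chi k '' {n | IsLn k n ∧ n ⊓ l = ⊥}) := by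
  by_cases hne : m = m'
  · subst hne
    rw [ZModModule.add_self]
    exact zero_mem _
  obtain ⟨g, hgB, hgw, rfl, rfl⟩ := exists_isometry_map_ruling hm hm' hne hw hwm hwm'
  have hy3 {y : Fin 4 → k} (hy : g y ∈ l) : y 3 = 0 := by
    have h := hl.2 w hwl (g y) hy
    rw [← hgw, hgB] at h
    simpa [B] using h
  have hspan {u z : Fin 4 → k} (hz : z ∈ span k {![1, 0, 0, 0], u}) (hu : g u ∈ l) : g z ∈ l := by
    obtain ⟨r, s, rfl⟩ := mem_span_pair.1 hz
    rw [map_add, map_smul, map_smul, hgw]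
    exact l.add_mem (l.smul_mem _ hwl) (l.smul_mem _ hu)
  have h2 : g ![0, 0, 1, 0] ∉ l := by
    intro h
    refine hml' (hm'.eq_of_le hl ?_)
    rintro _ ⟨z, hz, rfl⟩
    exact hspan hz h
  have h1 : g ![0, 1, 0, 0] ∉ l := by
    intro h
    refine hml (hm.eq_of_le hl ?_)
    rintro _ ⟨z, hz, rfl⟩
    exact hspan hz h
  have hsub {y u : Fin 4 → k} {r s : k} (hy : g y ∈ l) (hu : g u ∉ l)
      (hyu : y = r • ![1, 0, 0, 0] + s • u) : s = 0 := by
    by_contra hs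
    apply hu
    rw [hyu, map_add, map_smul, map_smul, hgw, l.add_mem_iff_right (l.smul_mem _ hwl),
      l.smul_mem_iff hs] at hy
    exact hy
  have hA (c : k) : chi k ((ruling c 1).map (g : (Fin 4 → k) →ₗ[k] (Fin 4 → k))) ∈
      span (ZMod 2) (chi k '' {n | IsLn k n ∧ n ⊓ l = ⊥}) := by
    refine subset_span ⟨_, ⟨(isLn_ruling (.inr one_ne_zero)).map hgB, ?_⟩, rfl⟩
    rw [eq_bot_iff]
    rintro _ ⟨⟨y, hy, rfl⟩, hyl⟩
    have h3 := hy3 hyl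
    obtain ⟨e0, e1⟩ := mem_ruling_one.1 hy
    rw [h3, mul_zero] at e1
    have hs := hsub (r := y 0) (s := y 2) hyl h2 (by ext i; fin_cases i <;> simp [h3, e1])
    rw [hs, mul_zero] at e0
    have : y = 0 := by ext i; fin_cases i <;> simp [*]
    simp [this]
  have hB (c : k) : chi k ((oppositeRuling c 1).map (g : (Fin 4 → k) →ₗ[k] (Fin 4 → k))) ∈
      span (ZMod 2) (chi k '' {n | IsLn k n ∧ n ⊓ l = ⊥}) := by
    refine subset_span ⟨_, ⟨(isLn_oppositeRuling hk (.inr one_ne_zero)).map hgB, ?_⟩, rfl⟩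
    rw [eq_bot_iff]
    rintro _ ⟨⟨y, hy, rfl⟩, hyl⟩
    have h3 := hy3 hyl
    obtain ⟨e0, e1⟩ := mem_oppositeRuling_one.1 hy
    rw [h3, mul_zero] at e1
    have hs := hsub (r := y 0) (s := y 1) hyl h1 (by ext i; fin_cases i <;> simp [h3, e1])
    rw [hs, mul_zero] at e0
    have : y = 0 := by ext i; fin_cases i <;> simp [*]
    simp [this]
  have hsum := sum_chi_ruling g
  rw [← eq_sub_iff_add_eq, ZModModule.sub_eq_add] at hsum
  rw [hsum, add_right_comm, add_right_comm (chi k _), ZModModule.add_self, zero_add]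
  exact add_mem (sum_mem fun c _ => hB c) (sum_mem fun c _ => hA c)

omit [Fintype k] in
lemma l0_eq_ruling : l0 k = ruling 1 0 := by
  rw [l0, ruling]
  congr 2
  · ext i; fin_cases i <;> simp [e]
  · congr 1; ext i; fin_cases i <;> simp [e]

variable (k)

theorem chi_l0_mem_span (t : ℕ) (ht : 0 < t) (q : ℕ)
    (hq : q = 2 ^ t) (hcard : Fintype.card k = q)
    -- `Y`: for each point `p ≠ p0` on `ℓ0`, a chosen line `ℓ_p ∈ L \ {ℓ0}` through `p`
    (lsel : Pt k → Submodule k (Fin 4 → k))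
    (hsel : ∀ p : Pt k, (p : Submodule k (Fin 4 → k)) ≤ l0 k →
      (p : Submodule k (Fin 4 → k)) ≠ p0 k →
      IsLn k (lsel p) ∧ lsel p ≠ l0 k ∧ (p : Submodule k (Fin 4 → k)) ≤ lsel p)
    (Y : Set (Pt k → ZMod 2))
    (hY : Y = (fun p => chi k (lsel p)) ''
      {p : Pt k | (p : Submodule k (Fin 4 → k)) ≤ l0 k ∧
        (p : Submodule k (Fin 4 → k)) ≠ p0 k}) :
    chi k (l0 k) ∈ span (ZMod 2) (X0 k ∪ Y ∪ chi k '' L1 k) := by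
  have hk : (2 : k) = 0 := by
    have h := FiniteField.cast_card_eq_zero k
    rw [hcard, hq, Nat.cast_pow] at h
    exact_mod_cast eq_zero_of_pow_eq_zero h
  have hl0 : IsLn k (l0 k) := l0_eq_ruling (k := k) ▸ isLn_ruling (.inl one_ne_zero)
  have hmem_l0 {x : Fin 4 → k} : x ∈ l0 k ↔ x 2 = 0 ∧ x 3 = 0 := by
    rw [l0_eq_ruling, mem_ruling_one_zero]
  set S := span (ZMod 2) (X0 k ∪ Y ∪ chi k '' L1 k) with hS
  have hL1 : span (ZMod 2) (chi k '' L1 k) ≤ S := span_mono Set.subset_union_right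
  have hA (c : k) : chi k (ruling c 1) ∈ S := by
    refine hL1 (subset_span ⟨_, ⟨isLn_ruling (.inr one_ne_zero), ?_⟩, rfl⟩)
    rw [eq_bot_iff]
    rintro y ⟨hy, hyl⟩
    obtain ⟨h2, h3⟩ := hmem_l0.1 hyl
    obtain ⟨h0, h1⟩ := mem_ruling_one.1 hy
    rw [h2, mul_zero] at h0
    rw [h3, mul_zero] at h1
    have : y = 0 := by ext i; fin_cases i <;> simp [*]
    simp [this]
  have hBinf : chi k (oppositeRuling 1 0) ∈ S := by
    refine subset_span (.inl (.inl ⟨⟨_, ⟨isLn_oppositeRuling hk (.inl one_ne_zero), ?_⟩, rfl⟩, ?_⟩))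
    · rw [p0, span_singleton_le_iff_mem, mem_oppositeRuling_one_zero]
      simp [e]
    · intro h
      have hv : (![0, 0, 1, 0] : Fin 4 → k) ≠ 0 := fun h => by simpa using congrFun h 2
      have h' := congrFun h ⟨span k {![0, 0, 1, 0]}, finrank_span_singleton hv⟩
      simp [chi, mem_oppositeRuling_one_zero, hmem_l0] at h'
  have hB (c : k) : chi k (oppositeRuling c 1) ∈ S := by
    have hw : (![c, 1, 0, 0] : Fin 4 → k) ≠ 0 := fun h => by simpa using congrFun h 1
    have hwl : ![c, 1, 0, 0] ∈ l0 k := by simp [hmem_l0]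
    let p : Pt k := ⟨span k {![c, 1, 0, 0]}, finrank_span_singleton hw⟩
    have hpl : (p : Submodule k (Fin 4 → k)) ≤ l0 k := (span_singleton_le_iff_mem _ _).2 hwl
    have hp0 : (p : Submodule k (Fin 4 → k)) ≠ p0 k := by
      intro h
      have hmem : ![c, 1, 0, 0] ∈ p0 k := h ▸ mem_span_singleton_self _
      obtain ⟨r, hr⟩ := mem_span_singleton.1 hmem
      simpa [e] using congrFun hr 1
    obtain ⟨hs1, hs2, hs3⟩ := hsel p hpl hp0
    have hY' : chi k (lsel p) ∈ S := by
      refine subset_span (.inl (.inr ?_))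
      rw [hY]
      exact ⟨p, ⟨hpl, hp0⟩, rfl⟩
    have hne : oppositeRuling c 1 ≠ l0 k := by
      intro h
      have hmem : ![0, 0, c, 1] ∈ oppositeRuling c 1 := mem_oppositeRuling_one.2 (by simp)
      rw [h, hmem_l0] at hmem
      simp at hmem
    have hadd := hL1 (chi_add_chi_mem_span hk hl0 (isLn_oppositeRuling hk (.inr one_ne_zero)) hs1
      hne hs2 hw hwl (mem_oppositeRuling_one.2 (by simp)) (hs3 (mem_span_singleton_self _)))
    exact (Submodule.add_mem_iff_left _ hY').1 hadd
  have hsum := sum_chi_ruling (LinearEquiv.refl k (Fin 4 → k))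
  simp only [LinearEquiv.refl_toLinearMap, Submodule.map_id] at hsum
  rw [l0_eq_ruling, eq_sub_of_add_eq hsum]
  exact sub_mem (add_mem hBinf (sum_mem fun c _ => hB c)) (sum_mem fun c _ => hA c)
end
end
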